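/- arXiv:1103.2747 — 2 statements merged into one kernel-verified Lean document; each statement's English description precedes it below -/
import Mathlib

section
/- Let R > 0, let B_R = {x ∈ B : d(x) < R} (the hyperbolic ball of radius R centered at 0, which equals the Euclidean ball of radius tanh(R/2)), and let α ∈ ℝ with n + α - 2 > 0. Then for every φ ∈ C_c^∞(B_R), ∫_{B_R} d^α |∇φ|² λ^{n-2} dx ≥ ((n + α - 2)/2)² ∫_{B_R} d^{α-2} φ² λ^n dx + (1/4) ∫_{B_R} d^α (R - d)^{-2} φ² λ^n dx. -/
open MeasureTheory

/-- Conformal factor of the Poincaré ball model. -/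
noncomputable def lam {n : ℕ} (x : EuclideanSpace ℝ (Fin n)) : ℝ := 2 / (1 - ‖x‖ ^ 2)

/-- Hyperbolic distance to the origin in the Poincaré ball model. -/
noncomputable def dH {n : ℕ} (x : EuclideanSpace ℝ (Fin n)) : ℝ :=
  Real.log ((1 + ‖x‖) / (1 - ‖x‖))

/-- The hyperbolic ball of radius `R` about the origin in the Poincaré ball model. -/
noncomputable def hypBall (n : ℕ) (R : ℝ) : Set (EuclideanSpace ℝ (Fin n)) :=
  {x ∈ Metric.ball (0 : EuclideanSpace ℝ (Fin n)) 1 | dH x < R}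

open Set Metric Module

/-- Hyperbolic distance to the origin as a function of the Euclidean distance. -/
noncomputable def radialDist (r : ℝ) : ℝ := Real.log ((1 + r) / (1 - r))

/-- Conformal factor of the Poincaré ball model as a function of the Euclidean distance. -/
noncomputable def radialLam (r : ℝ) : ℝ := 2 / (1 - r ^ 2)

theorem radialLam_pos {r : ℝ} (h0 : 0 ≤ r) (h1 : r < 1) : 0 < radialLam r := by
  have : 0 < 1 - r ^ 2 := by nlinarith
  unfold radialLam
  positivity

theorem two_mul_le_radialDist {r : ℝ} (h0 : 0 ≤ r) (h1 : r < 1) : 2 * r ≤ radialDist r := by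
  have h : 0 < 1 - r := by linarith
  have key := Real.le_log_one_add_of_nonneg (x := 2 * r / (1 - r)) (by positivity)
  have e1 : 1 + 2 * r / (1 - r) = (1 + r) / (1 - r) := by field_simp; ring
  have e2 : 2 * (2 * r / (1 - r)) / (2 * r / (1 - r) + 2) = 2 * r := by field_simp; ring
  rwa [e1, e2] at key

theorem radialDist_pos {r : ℝ} (h0 : 0 < r) (h1 : r < 1) : 0 < radialDist r := by
  linarith [two_mul_le_radialDist h0.le h1]

theorem radialDist_le {r : ℝ} (h0 : 0 ≤ r) (h1 : r < 1) : radialDist r ≤ 2 * r / (1 - r) := by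
  have h : 0 < 1 - r := by linarith
  have key := Real.log_le_sub_one_of_pos (x := (1 + r) / (1 - r)) (by positivity)
  have e : (1 + r) / (1 - r) - 1 = 2 * r / (1 - r) := by field_simp; ring
  rwa [e] at key

theorem radialDist_lt_iff {r R : ℝ} (h0 : 0 ≤ r) (h1 : r < 1) :
    radialDist r < R ↔ r < (Real.exp R - 1) / (Real.exp R + 1) := by
  have h : 0 < 1 - r := by linarith
  have hE := Real.exp_pos R
  rw [radialDist, Real.log_lt_iff_lt_exp (by positivity), div_lt_iff₀ h, lt_div_iff₀ (by positivity)]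
  constructor <;> intro <;> linarith

theorem hasDerivAt_radialDist {r : ℝ} (h0 : 0 ≤ r) (h1 : r < 1) :
    HasDerivAt radialDist (radialLam r) r := by
  have h : 1 - r ≠ 0 := by linarith
  have h' : 1 + r ≠ 0 := by linarith
  have h2 : 1 - r ^ 2 ≠ 0 := by nlinarith
  refine HasDerivAt.congr_deriv (f := radialDist)
    ((((hasDerivAt_id r).const_add 1).div ((hasDerivAt_id r).const_sub 1) h).log
      (div_ne_zero h' h)) ?_
  simp only [radialLam, id, Pi.div_apply]
  field_simp
  ring

theorem hasDerivAt_mul_radialLam {r : ℝ} (h0 : 0 ≤ r) (h1 : r < 1) :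
    HasDerivAt (fun r ↦ r * radialLam r) (2 * (1 + r ^ 2) / (1 - r ^ 2) ^ 2) r := by
  have h2 : 1 - r ^ 2 ≠ 0 := by nlinarith
  refine HasDerivAt.congr_deriv (f := fun r ↦ r * radialLam r) ((hasDerivAt_id r).mul
    ((hasDerivAt_const r (2 : ℝ)).div ((hasDerivAt_pow 2 r).const_sub 1) h2)) ?_
  simp only [id, radialLam]
  field_simp
  ring

/-- The radial Hardy weight `(β / 2)² d⁻² + (1 / 4) (R - d)⁻²` in terms of `d`. -/
noncomputable def hardyWeight (β R d : ℝ) : ℝ := (β / 2) ^ 2 / d ^ 2 + 1 / 4 / (R - d) ^ 2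

/-- Minus the logarithmic derivative of the ground state `d ^ (-β / 2) * (R - d) ^ (1 / 2)`. -/
noncomputable def groundSlope (β R d : ℝ) : ℝ := β / (2 * d) + 1 / (2 * (R - d))

theorem groundSlope_pos {β R d : ℝ} (hβ : 0 < β) (hd : 0 < d) (hR : d < R) :
    0 < groundSlope β R d := by
  have : 0 < R - d := by linarith
  unfold groundSlope
  positivity

theorem hasDerivAt_groundSlope {β R d : ℝ} (hd : 0 < d) (hR : d < R) :
    HasDerivAt (groundSlope β R) (-β / (2 * d ^ 2) + 1 / (2 * (R - d) ^ 2)) d := by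
  have h : R - d ≠ 0 := by linarith
  have h1 := (hasDerivAt_const d β).div ((hasDerivAt_id d).const_mul 2) (by simpa using hd.ne')
  have h2 := (hasDerivAt_const d (1 : ℝ)).div (((hasDerivAt_id d).const_sub R).const_mul 2)
    (by simpa using h)
  refine HasDerivAt.congr_deriv (f := groundSlope β R) (h1.add h2) ?_
  simp only [id]
  field_simp
  ring

theorem hardyWeight_add_sq_le {β R d : ℝ} (hd : 0 < d) (hR : d < R) :
    hardyWeight β R d + groundSlope β R d ^ 2 ≤
      (-β / (2 * d ^ 2) + 1 / (2 * (R - d) ^ 2)) + groundSlope β R d * ((β + 1) / d) := by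
  have h : 0 < R - d := by linarith
  have e : (-β / (2 * d ^ 2) + 1 / (2 * (R - d) ^ 2)) + groundSlope β R d * ((β + 1) / d) -
      (hardyWeight β R d + groundSlope β R d ^ 2) = 1 / (2 * d * (R - d)) := by
    unfold hardyWeight groundSlope
    field_simp
    ring
  have : 0 < 1 / (2 * d * (R - d)) := by positivity
  linarith

/-- Density of the weight `d ^ α` in geodesic polar coordinates in dimension `m + 1`. -/
noncomputable def radialDensity (α : ℝ) (m : ℕ) (r : ℝ) : ℝ :=
  radialDist r ^ α * (r * radialLam r) ^ m

theorem radialDensity_pos {α : ℝ} {m : ℕ} {r : ℝ} (h0 : 0 < r) (h1 : r < 1) :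
    0 < radialDensity α m r := by
  have := radialDist_pos h0 h1
  have := radialLam_pos h0.le h1
  unfold radialDensity
  positivity

theorem exists_hasDerivAt_radialDensity {α : ℝ} {m : ℕ} {r : ℝ} (h0 : 0 < r) (h1 : r < 1) :
    ∃ W', HasDerivAt (radialDensity α m) W' r ∧
      radialLam r * radialDensity α m r * ((m + α) / radialDist r) ≤ W' := by
  have hD := radialDist_pos h0 h1
  have hL := radialLam_pos h0.le h1
  refine ⟨_, ((hasDerivAt_radialDist h0.le h1).rpow_const (p := α) (.inl hD.ne')).mul
    ((hasDerivAt_mul_radialLam h0.le h1).pow m), ?_⟩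
  have h2 : 0 < 1 - r ^ 2 := by nlinarith
  have hS : (m : ℝ) * (r * radialLam r) ^ m * (radialLam r / radialDist r) ≤
      m * (r * radialLam r) ^ (m - 1) * (2 * (1 + r ^ 2) / (1 - r ^ 2) ^ 2) := by
    rcases m with _ | m
    · simp
    · have : r * radialLam r * (radialLam r / radialDist r) ≤
          2 * (1 + r ^ 2) / (1 - r ^ 2) ^ 2 := by
        calc r * radialLam r * (radialLam r / radialDist r)
            ≤ r * radialLam r * (radialLam r / (2 * r)) := by
              gcongr
              exact two_mul_le_radialDist h0.le h1
          _ = 2 / (1 - r ^ 2) ^ 2 := by unfold radialLam; field_simp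
          _ ≤ _ := by gcongr; nlinarith
      rw [Nat.add_sub_cancel, pow_succ, ← mul_assoc, mul_assoc _ (r * radialLam r)]
      gcongr
  have hX : 0 < radialDist r ^ α := by positivity
  rw [Real.rpow_sub_one hD.ne']
  simp only [radialDensity]
  have := mul_le_mul_of_nonneg_left hS hX.le
  calc _ = radialLam r * α * (radialDist r ^ α / radialDist r) * (r * radialLam r) ^ m +
        radialDist r ^ α * (m * (r * radialLam r) ^ m * (radialLam r / radialDist r)) := by ring
    _ ≤ _ := by gcongr

theorem exists_hasDerivAt_flux {α β R : ℝ} {m : ℕ} {r v v' : ℝ} {u : ℝ → ℝ} (hβ : 0 < β)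
    (hm : β + 1 = m + α) (h0 : 0 < r) (h1 : r < 1) (hR : radialDist r < R)
    (hv : u r = v) (hu : HasDerivAt u v' r) :
    ∃ F', HasDerivAt
        (fun r ↦ -(groundSlope β R (radialDist r) * radialDensity α m r * u r ^ 2)) F' r ∧
      F' ≤ radialDensity α m r * (v' ^ 2 / radialLam r) -
        radialDensity α m r * (radialLam r * hardyWeight β R (radialDist r) * v ^ 2) := by
  have hD := radialDist_pos h0 h1
  have hL := radialLam_pos h0.le h1
  have hg := groundSlope_pos hβ hD hR
  obtain ⟨W', hW', hle⟩ := exists_hasDerivAt_radialDensity (α := α) (m := m) h0 h1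
  have hW := radialDensity_pos (α := α) (m := m) h0 h1
  have hslope := (hasDerivAt_groundSlope (β := β) hD hR).comp r (hasDerivAt_radialDist h0.le h1)
  refine ⟨_, ((hslope.mul hW').mul (hu.pow 2)).neg, ?_⟩
  have key := hardyWeight_add_sq_le (β := β) hD hR
  rw [hm] at key
  simp only [Pi.mul_apply, Pi.pow_apply, Function.comp_apply, hv]
  set D := radialDist r
  set L := radialLam r
  set W := radialDensity α m r
  set g := groundSlope β R D
  set G' := -β / (2 * D ^ 2) + 1 / (2 * (R - D) ^ 2)
  set V := hardyWeight β R D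
  have hK : L * W * (V + g ^ 2) ≤ G' * L * W + g * W' := by
    have a := mul_le_mul_of_nonneg_left key (mul_pos hL hW).le
    have b := mul_le_mul_of_nonneg_left hle hg.le
    linarith
  have hsq : 0 ≤ W / L * (v' + L * g * v) ^ 2 := by positivity
  have e : W / L * (v' + L * g * v) ^ 2 =
      W * (v' ^ 2 / L) + 2 * g * W * v * v' + L * W * g ^ 2 * v ^ 2 := by
    field_simp
    ring
  have c := mul_le_mul_of_nonneg_right hK (sq_nonneg v)
  norm_num
  linarith

theorem continuousOn_radialDist : ContinuousOn radialDist (Ico 0 1) := fun _ hr ↦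
  (hasDerivAt_radialDist hr.1 hr.2).continuousAt.continuousWithinAt

theorem continuousOn_radialLam : ContinuousOn radialLam (Ico 0 1) := by
  unfold radialLam
  refine continuousOn_const.div (by fun_prop) fun r hr ↦ ?_
  have := hr.1
  have := hr.2
  nlinarith

theorem radialDist_lt_of_le {r b R : ℝ} (h0 : 0 ≤ r) (hrb : r ≤ b) (hb1 : b < 1)
    (hbR : radialDist b < R) : radialDist r < R := by
  rw [radialDist_lt_iff h0 (by linarith)]
  exact hrb.trans_lt ((radialDist_lt_iff (h0.trans hrb) hb1).1 hbR)

theorem integral_radial_hardy_le {α β R ε b : ℝ} {m : ℕ} {u u' N : ℝ → ℝ} (hβ : 0 < β)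
    (hm : β + 1 = m + α) (hε : 0 < ε) (hεb : ε ≤ b) (hb1 : b < 1) (hbR : radialDist b < R)
    (hu : ∀ r, HasDerivAt u (u' r) r) (hN : Continuous N) (huN : ∀ r, |u' r| ≤ N r)
    (hub : u b = 0) :
    IntegrableOn (fun r ↦ radialDensity α m r *
      (radialLam r * hardyWeight β R (radialDist r) * u r ^ 2)) (Icc ε b) ∧
    IntegrableOn (fun r ↦ radialDensity α m r * (N r ^ 2 / radialLam r)) (Icc ε b) ∧
    ∫ r in ε..b, radialDensity α m r * (radialLam r * hardyWeight β R (radialDist r) * u r ^ 2) ≤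
      ∫ r in ε..b, radialDensity α m r * (N r ^ 2 / radialLam r) := by
  have hsub : Icc ε b ⊆ Ico 0 1 := fun r hr ↦ ⟨hε.le.trans hr.1, hr.2.trans_lt hb1⟩
  have hpos : ∀ r ∈ Icc ε b, 0 < r := fun r hr ↦ hε.trans_le hr.1
  have hlt : ∀ r ∈ Icc ε b, radialDist r < R := fun r hr ↦
    radialDist_lt_of_le (hpos r hr).le hr.2 hb1 hbR
  have hDpos : ∀ r ∈ Icc ε b, 0 < radialDist r := fun r hr ↦
    radialDist_pos (hpos r hr) (hsub hr).2
  have cD := continuousOn_radialDist.mono hsub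
  have cL := continuousOn_radialLam.mono hsub
  have cu : Continuous u := continuous_iff_continuousAt.2 fun r ↦ (hu r).continuousAt
  have cW : ContinuousOn (radialDensity α m) (Icc ε b) :=
    (cD.rpow_const fun r hr ↦ .inl (hDpos r hr).ne').mul ((continuousOn_id.mul cL).pow m)
  have cV : ContinuousOn (fun r ↦ hardyWeight β R (radialDist r)) (Icc ε b) :=
    (continuousOn_const.div (cD.pow 2) fun r hr ↦ (pow_pos (hDpos r hr) 2).ne').add
      (continuousOn_const.div ((continuousOn_const.sub cD).pow 2) fun r hr ↦
        (pow_pos (sub_pos.2 (hlt r hr)) 2).ne')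
  have cP : ContinuousOn (fun r ↦ radialDensity α m r *
      (radialLam r * hardyWeight β R (radialDist r) * u r ^ 2)) (Icc ε b) :=
    cW.mul ((cL.mul cV).mul (cu.continuousOn.pow 2))
  have cQ : ContinuousOn (fun r ↦ radialDensity α m r * (N r ^ 2 / radialLam r)) (Icc ε b) :=
    cW.mul ((hN.continuousOn.pow 2).div cL
      fun r hr ↦ (radialLam_pos (hsub hr).1 (hsub hr).2).ne')
  have iP := cP.integrableOn_compact (μ := volume) isCompact_Icc
  have iQ := cQ.integrableOn_compact (μ := volume) isCompact_Icc
  refine ⟨iP, iQ, ?_⟩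
  have hflux : ∀ r ∈ Icc ε b, ∃ F', HasDerivAt
      (fun r ↦ -(groundSlope β R (radialDist r) * radialDensity α m r * u r ^ 2)) F' r ∧
      F' ≤ radialDensity α m r * (u' r ^ 2 / radialLam r) -
        radialDensity α m r * (radialLam r * hardyWeight β R (radialDist r) * u r ^ 2) :=
    fun r hr ↦ exists_hasDerivAt_flux hβ hm (hpos r hr) (hsub hr).2 (hlt r hr) rfl (hu r)
  choose! F' hF' hF'le using hflux
  have key := intervalIntegral.sub_le_integral_of_hasDeriv_right_of_le hεb
    (fun r hr ↦ (hF' r hr).continuousAt.continuousWithinAt)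
    (fun r hr ↦ (hF' r (Ioo_subset_Icc_self hr)).hasDerivWithinAt) (iQ.sub iP)
    (fun r hr ↦ (hF'le r (Ioo_subset_Icc_self hr)).trans <| by
      have hr' := Ioo_subset_Icc_self hr
      have := radialDensity_pos (α := α) (m := m) (hpos r hr') (hsub hr').2
      have := radialLam_pos (hsub hr').1 (hsub hr').2
      have := sq_le_sq.2 ((huN r).trans (le_abs_self _))
      simp only [Pi.sub_apply]
      gcongr)
  have hεm : ε ∈ Icc ε b := left_mem_Icc.2 hεb
  have : 0 ≤ groundSlope β R (radialDist ε) * radialDensity α m ε * u ε ^ 2 := by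
    have := groundSlope_pos hβ (hDpos ε hεm) (hlt ε hεm)
    have := radialDensity_pos (α := α) (m := m) hε (hsub hεm).2
    positivity
  simp only [Pi.sub_apply] at key
  rw [intervalIntegral.integral_sub] at key
  · simp only [hub] at key
    norm_num at key
    linarith
  · exact (intervalIntegrable_iff_integrableOn_Icc_of_le hεb).2 iQ
  · exact (intervalIntegrable_iff_integrableOn_Icc_of_le hεb).2 iP

theorem setLIntegral_Ioi_le_of_forall_pos {f g : ℝ → ENNReal}
    (h : ∀ ε > 0, ∫⁻ r in Ioi ε, f r ≤ ∫⁻ r in Ioi ε, g r) :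
    ∫⁻ r in Ioi 0, f r ≤ ∫⁻ r in Ioi 0, g r := by
  have hU : Ioi (0 : ℝ) = ⋃ k : ℕ, Ioi (1 / ((k : ℝ) + 1)) := by
    ext r
    simp only [mem_Ioi, mem_iUnion]
    exact ⟨exists_nat_one_div_lt, fun ⟨k, hk⟩ ↦ lt_trans (by positivity) hk⟩
  rw [hU, setLIntegral_iUnion_of_directed, setLIntegral_iUnion_of_directed]
  · exact iSup_mono fun k ↦ h _ (by positivity)
  all_goals exact directed_of_isDirected_le fun i j hij ↦
    Ioi_subset_Ioi (Nat.one_div_le_one_div hij)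

theorem lintegral_radial_hardy_le {α β R b : ℝ} {m : ℕ} {u u' N : ℝ → ℝ} (hβ : 0 < β)
    (hm : β + 1 = m + α) (hb1 : b < 1) (hbR : radialDist b < R)
    (hu : ∀ r, HasDerivAt u (u' r) r) (hN : Continuous N) (huN : ∀ r, |u' r| ≤ N r)
    (hub : ∀ r, b ≤ r → u r = 0) :
    ∫⁻ r in Ioi 0, ENNReal.ofReal (radialDensity α m r *
        (radialLam r * hardyWeight β R (radialDist r) * u r ^ 2)) ≤
      ∫⁻ r in Ioi 0, ENNReal.ofReal (radialDensity α m r * (N r ^ 2 / radialLam r)) := by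
  refine setLIntegral_Ioi_le_of_forall_pos fun ε hε ↦ ?_
  have hz : ∀ c, b ≤ c → ∫⁻ r in Ioi c, ENNReal.ofReal (radialDensity α m r *
      (radialLam r * hardyWeight β R (radialDist r) * u r ^ 2)) = 0 := fun c hc ↦ by
    rw [setLIntegral_congr_fun (g := fun _ ↦ 0) measurableSet_Ioi]
    · simp
    · intro r hr
      simp [hub r (hc.trans (le_of_lt hr))]
  rcases le_total b ε with h | hεb
  · simp [hz ε h]
  obtain ⟨iP, iQ, hle⟩ := integral_radial_hardy_le (α := α) (m := m) hβ hm hε hεb hb1 hbR hu hN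
    huN (hub b le_rfl)
  have hpos : ∀ r ∈ Ioc ε b, 0 < radialDensity α m r ∧ 0 < radialLam r := fun r hr ↦
    ⟨radialDensity_pos (hε.trans hr.1) (hr.2.trans_lt hb1),
      radialLam_pos (hε.trans hr.1).le (hr.2.trans_lt hb1)⟩
  rw [← Ioc_union_Ioi_eq_Ioi hεb, lintegral_union measurableSet_Ioi (Ioc_disjoint_Ioi le_rfl),
    hz b le_rfl, add_zero]
  refine le_trans ?_ (lintegral_mono_set subset_union_left)
  rw [intervalIntegral.integral_of_le hεb, intervalIntegral.integral_of_le hεb] at hle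
  rw [← ofReal_integral_eq_lintegral_ofReal (iP.mono_set Ioc_subset_Icc_self),
    ← ofReal_integral_eq_lintegral_ofReal (iQ.mono_set Ioc_subset_Icc_self)]
  · exact ENNReal.ofReal_le_ofReal hle
  · refine (ae_restrict_mem measurableSet_Ioc).mono fun r hr ↦ ?_
    obtain ⟨h1, h2⟩ := hpos r hr
    simp only [Pi.zero_apply]
    positivity
  · refine (ae_restrict_mem measurableSet_Ioc).mono fun r hr ↦ ?_
    obtain ⟨h1, h2⟩ := hpos r hr
    simp only [Pi.zero_apply, hardyWeight]
    positivity

section Polar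

variable {E : Type*} [NormedAddCommGroup E] [NormedSpace ℝ E] [Nontrivial E]
  [FiniteDimensional ℝ E] [MeasurableSpace E] [BorelSpace E] (μ : Measure E) [μ.IsAddHaarMeasure]

theorem lintegral_eq_lintegral_sphere {f : E → ENNReal} (hf : Measurable f) :
    ∫⁻ x, f x ∂μ = ∫⁻ ω : sphere (0 : E) 1, (∫⁻ r in Ioi (0 : ℝ),
      ENNReal.ofReal (r ^ (finrank ℝ E - 1)) * f (r • (ω : E))) ∂μ.toSphere := by
  calc
    ∫⁻ x, f x ∂μ = ∫⁻ x : ({(0)}ᶜ : Set E), f x ∂(μ.comap (↑)) := by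
      rw [lintegral_subtype_comap (measurableSet_singleton _).compl f, restrict_compl_singleton]
    _ = ∫⁻ p : sphere (0 : E) 1 × Ioi (0 : ℝ), f ((p.2 : ℝ) • (p.1 : E))
          ∂μ.toSphere.prod (.volumeIoiPow (finrank ℝ E - 1)) := by
      rw [← μ.measurePreserving_homeomorphUnitSphereProd.lintegral_comp_emb
        (Homeomorph.measurableEmbedding _)]
      refine lintegral_congr fun x ↦ ?_
      have : ‖(x : E)‖ ≠ 0 := norm_ne_zero_iff.2 x.2
      simp [smul_smul, this]
    _ = _ := by
      rw [lintegral_prod _ (by fun_prop)]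
      refine lintegral_congr fun ω ↦ ?_
      rw [Measure.volumeIoiPow, lintegral_withDensity_eq_lintegral_mul _ (by fun_prop)
        (by fun_prop)]
      exact lintegral_subtype_comap measurableSet_Ioi
        (fun r ↦ ENNReal.ofReal (r ^ (finrank ℝ E - 1)) * f (r • (ω : E)))

theorem integrableOn_norm_rpow_ball {s b : ℝ} (hs : 0 < finrank ℝ E + s) :
    IntegrableOn (fun x : E ↦ ‖x‖ ^ s) (ball 0 b) μ := by
  rw [integrableOn_fun_norm_addHaar μ (f := fun r ↦ r ^ s)]
  have hd : 0 < finrank ℝ E := finrank_pos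
  have h := (intervalIntegral.intervalIntegrable_rpow' (a := 0) (b := b)
    (r := (finrank ℝ E - 1 : ℕ) + s) (by push_cast [Nat.cast_pred hd]; linarith)).1
  refine (h.mono_set Ioo_subset_Ioc_self).congr_fun (fun r hr ↦ ?_) measurableSet_Ioo
  simp [Real.rpow_add hr.1]

end Polar

section Radial

variable {n : ℕ}

theorem dH_eq (x : EuclideanSpace ℝ (Fin n)) : dH x = radialDist ‖x‖ := rfl

theorem lam_eq (x : EuclideanSpace ℝ (Fin n)) : lam x = radialLam ‖x‖ := rfl

theorem measurable_dH : Measurable (dH : EuclideanSpace ℝ (Fin n) → ℝ) := by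
  unfold dH
  fun_prop

theorem measurable_lam : Measurable (lam : EuclideanSpace ℝ (Fin n) → ℝ) := by
  unfold lam
  fun_prop

theorem hypBall_subset_ball {R : ℝ} :
    hypBall n R ⊆ ball 0 (min 1 ((Real.exp R - 1) / (Real.exp R + 1))) := fun x hx ↦ by
  have h1 : ‖x‖ < 1 := by simpa using hx.1
  rw [mem_ball_zero_iff, lt_min_iff]
  exact ⟨h1, (radialDist_lt_iff (norm_nonneg x) h1).1 hx.2⟩

theorem exists_subset_ball_of_subset_hypBall {R : ℝ} (hR : 0 < R)
    {s : Set (EuclideanSpace ℝ (Fin n))} (hs : IsClosed s) (hsR : s ⊆ hypBall n R) :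
    ∃ b, 0 < b ∧ b < 1 ∧ radialDist b < R ∧ s ⊆ ball 0 b := by
  have hE : 1 < Real.exp R := Real.one_lt_exp_iff.2 hR
  have hpos : 0 < min 1 ((Real.exp R - 1) / (Real.exp R + 1)) :=
    lt_min one_pos (div_pos (by linarith) (by linarith))
  obtain ⟨b, ⟨hb0, hb⟩, hsb⟩ := exists_pos_lt_subset_ball hpos hs (hsR.trans hypBall_subset_ball)
  obtain ⟨hb1, hb2⟩ := lt_min_iff.1 hb
  exact ⟨b, hb0, hb1, (radialDist_lt_iff hb0.le hb1).2 hb2, hsb⟩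

theorem dH_rpow_le {α b : ℝ} (hb1 : b < 1) {x : EuclideanSpace ℝ (Fin n)} (hx0 : x ≠ 0)
    (hxb : ‖x‖ ≤ b) : dH x ^ α ≤ (2 ^ α + (2 / (1 - b)) ^ α) * ‖x‖ ^ α := by
  have hr : 0 < ‖x‖ := norm_pos_iff.2 hx0
  have hb : 0 < 1 - b := by linarith
  have h1 := two_mul_le_radialDist hr.le (hxb.trans_lt hb1)
  have h2 : radialDist ‖x‖ ≤ 2 / (1 - b) * ‖x‖ := by
    refine (radialDist_le hr.le (hxb.trans_lt hb1)).trans ?_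
    rw [div_mul_eq_mul_div]
    gcongr
  have hD := radialDist_pos hr (hxb.trans_lt hb1)
  rw [dH_eq, add_mul, ← Real.mul_rpow (by positivity) hr.le,
    ← Real.mul_rpow (by positivity) hr.le]
  rcases le_total 0 α with hα | hα
  · have := Real.rpow_le_rpow hD.le h2 hα
    have : 0 ≤ (2 * ‖x‖) ^ α := by positivity
    linarith
  · have := Real.rpow_le_rpow_of_nonpos (by positivity) h1 hα
    have : 0 ≤ (2 / (1 - b) * ‖x‖) ^ α := by positivity
    linarith

theorem integrable_dH_rpow_mul {α b : ℝ} [Nontrivial (EuclideanSpace ℝ (Fin n))]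
    (hα : 0 < n + α) (hb1 : b < 1)
    {h : EuclideanSpace ℝ (Fin n) → ℝ} (hmeas : Measurable h)
    (hh : ContinuousOn h (closedBall 0 b)) (h0 : ∀ x, b ≤ ‖x‖ → h x = 0) :
    Integrable (fun x ↦ dH x ^ α * h x) := by
  obtain ⟨C, hC⟩ := (isCompact_closedBall 0 b).exists_bound_of_continuousOn hh
  have hint := (integrableOn_norm_rpow_ball (E := EuclideanSpace ℝ (Fin n)) volume (s := α)
    (b := b) (by simpa using hα)).const_mul ((2 ^ α + (2 / (1 - b)) ^ α) * C)
  rw [← integrableOn_iff_integrable_of_support_subset (s := ball 0 b)]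
  · refine hint.mono' ((measurable_dH.pow_const α).mul hmeas).aestronglyMeasurable ?_
    filter_upwards [ae_restrict_mem measurableSet_ball,
      ae_restrict_of_ae (Measure.ae_ne volume 0)] with x hx hx0
    have hxb : ‖x‖ < b := by simpa using hx
    have h1 := dH_rpow_le (α := α) hb1 hx0 hxb.le
    have h2 := hC x (by simpa using hxb.le)
    have hD := radialDist_pos (norm_pos_iff.2 hx0) (hxb.trans hb1)
    rw [← dH_eq] at hD
    rw [norm_mul, Real.norm_of_nonneg (by positivity), mul_right_comm]
    have hb : 0 < 1 - b := by linarith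
    gcongr
  · intro x hx
    by_contra hxb
    exact hx (by simp [h0 x (by simpa using hxb)])

theorem continuous_gradient {φ : EuclideanSpace ℝ (Fin n) → ℝ} (hφ : ContDiff ℝ 1 φ) :
    Continuous (gradient φ) :=
  (InnerProductSpace.toDual ℝ _).symm.continuous.comp (hφ.continuous_fderiv one_ne_zero)

theorem norm_gradient (φ : EuclideanSpace ℝ (Fin n) → ℝ) (x : EuclideanSpace ℝ (Fin n)) :
    ‖gradient φ x‖ = ‖fderiv ℝ φ x‖ :=
  (InnerProductSpace.toDual ℝ _).symm.norm_map _

theorem eq_zero_of_le_norm {φ : EuclideanSpace ℝ (Fin n) → ℝ} {b : ℝ}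
    (hsupp : tsupport φ ⊆ ball 0 b) {x : EuclideanSpace ℝ (Fin n)} (hx : b ≤ ‖x‖) : φ x = 0 :=
  image_eq_zero_of_notMem_tsupport fun h ↦ by
    simpa using (mem_ball_zero_iff.1 (hsupp h)).trans_le hx

theorem gradient_eq_zero_of_le_norm {φ : EuclideanSpace ℝ (Fin n) → ℝ} {b : ℝ}
    (hsupp : tsupport φ ⊆ ball 0 b) {x : EuclideanSpace ℝ (Fin n)} (hx : b ≤ ‖x‖) :
    gradient φ x = 0 := by
  rw [← norm_eq_zero, norm_gradient, norm_eq_zero]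
  refine image_eq_zero_of_notMem_tsupport fun h ↦ ?_
  simpa using (mem_ball_zero_iff.1 (hsupp (tsupport_fderiv_subset ℝ h))).trans_le hx

theorem lintegral_hardy_le {m : ℕ} {R α b : ℝ} {φ : EuclideanSpace ℝ (Fin (m + 1)) → ℝ}
    (hα : 0 < ((m + 1 : ℕ) : ℝ) + α - 2) (hφ : ContDiff ℝ 1 φ) (hb1 : b < 1)
    (hbR : radialDist b < R) (hsupp : tsupport φ ⊆ ball 0 b) :
    ∫⁻ x, ENNReal.ofReal (((((m + 1 : ℕ) : ℝ) + α - 2) / 2) ^ 2 *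
          (dH x ^ (α - 2) * φ x ^ 2 * lam x ^ ((m + 1 : ℕ) : ℝ)) +
        1 / 4 * (dH x ^ α * (φ x ^ 2 / (R - dH x) ^ 2) * lam x ^ ((m + 1 : ℕ) : ℝ))) ≤
      ∫⁻ x, ENNReal.ofReal
        (dH x ^ α * ‖gradient φ x‖ ^ 2 * lam x ^ (((m + 1 : ℕ) : ℝ) - 2)) := by
  have hd := measurable_dH (n := m + 1)
  have hl := measurable_lam (n := m + 1)
  have hφm := hφ.continuous.measurable
  have hgc := continuous_gradient hφ
  have hgm := hgc.measurable
  iterate 2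
    rw [lintegral_eq_lintegral_sphere (E := EuclideanSpace ℝ (Fin (m + 1))) _ (by fun_prop)]
  refine lintegral_mono fun ω ↦ ?_
  have hω : ‖(ω : EuclideanSpace ℝ (Fin (m + 1)))‖ = 1 := norm_eq_of_mem_sphere ω
  have hnorm : ∀ r : ℝ, 0 ≤ r → ‖r • (ω : EuclideanSpace ℝ (Fin (m + 1)))‖ = r := fun r hr ↦ by
    rw [norm_smul, hω, mul_one, Real.norm_of_nonneg hr]
  have hdim : finrank ℝ (EuclideanSpace ℝ (Fin (m + 1))) - 1 = m := by simp
  have key := lintegral_radial_hardy_le (α := α) (β := ((m + 1 : ℕ) : ℝ) + α - 2) (m := m)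
    (u := fun r ↦ φ (r • (ω : EuclideanSpace ℝ (Fin (m + 1)))))
    (u' := fun r ↦ fderiv ℝ φ (r • (ω : EuclideanSpace ℝ (Fin (m + 1)))) ω)
    (N := fun r ↦ ‖gradient φ (r • (ω : EuclideanSpace ℝ (Fin (m + 1))))‖)
    hα (by push_cast; ring) hb1 hbR
    (fun r ↦ by
      have h1 := (hφ.differentiable one_ne_zero
        (r • (ω : EuclideanSpace ℝ (Fin (m + 1))))).hasFDerivAt
      have h2 := (hasDerivAt_id r).smul_const (ω : EuclideanSpace ℝ (Fin (m + 1)))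
      exact (h1.comp_hasDerivAt r h2).congr_deriv (by simp))
    (by fun_prop)
    (fun r ↦ by
      rw [norm_gradient, ← Real.norm_eq_abs]
      simpa [hω] using (fderiv ℝ φ (r • (ω : EuclideanSpace ℝ (Fin (m + 1))))).le_opNorm ω)
    (fun r hr ↦ eq_zero_of_le_norm hsupp (by
      rw [norm_smul, hω, mul_one]
      exact hr.trans (le_abs_self r)))
  convert key using 1
  all_goals
    refine setLIntegral_congr_fun measurableSet_Ioi fun r hr ↦ ?_
    have hr0 : 0 < r := hr
    rw [hdim]
    rw [← ENNReal.ofReal_mul (by positivity)]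
    congr 1
    rw [dH_eq, lam_eq, hnorm r hr0.le]
    rcases le_or_gt b r with hbr | hbr
    · have hn : b ≤ ‖r • (ω : EuclideanSpace ℝ (Fin (m + 1)))‖ := by rwa [hnorm r hr0.le]
      simp [eq_zero_of_le_norm hsupp hn, gradient_eq_zero_of_le_norm hsupp hn]
    have hD := radialDist_pos hr0 (hbr.trans hb1)
    have hL := radialLam_pos hr0.le (hbr.trans hb1)
    have hRD : R - radialDist r ≠ 0 := (sub_pos.2 (radialDist_lt_of_le hr0.le hbr.le hb1 hbR)).ne'
  · rw [Real.rpow_natCast, Real.rpow_sub hD, Real.rpow_two]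
    unfold radialDensity hardyWeight
    field_simp
    ring
  · rw [Real.rpow_sub hL, Real.rpow_natCast, Real.rpow_two]
    unfold radialDensity
    field_simp
    ring

end Radial

/-- Weighted L² Hardy inequality on a hyperbolic ball with distance-to-boundary
remainder (Corollary 2.2). -/
theorem hardy_hyperbolic_ball_remainder {n : ℕ} (R : ℝ) (hR : 0 < R)
    (α : ℝ) (hα : 0 < (n : ℝ) + α - 2)
    (φ : EuclideanSpace ℝ (Fin n) → ℝ)
    (hφ_smooth : ContDiff ℝ (⊤ : ℕ∞) φ) (hφ_cpt : HasCompactSupport φ)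
    (hφ_supp : tsupport φ ⊆ hypBall n R) :
    (((n : ℝ) + α - 2) / 2) ^ 2 *
          (∫ x in hypBall n R, dH x ^ (α - 2) * φ x ^ 2 * lam x ^ (n : ℝ)) +
        (1 / 4) * ∫ x in hypBall n R,
          dH x ^ α * (φ x ^ 2 / (R - dH x) ^ 2) * lam x ^ (n : ℝ) ≤
      ∫ x in hypBall n R, dH x ^ α * ‖gradient φ x‖ ^ 2 * lam x ^ ((n : ℝ) - 2) := by
  rcases n with _ | m
  · have hα' : α - 2 ≠ 0 := by
      norm_num at hα
      linarith
    have hα'' : α ≠ 0 := by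
      norm_num at hα
      linarith
    have hd : ∀ x : EuclideanSpace ℝ (Fin 0), dH x = 0 := fun x ↦ by
      rw [Subsingleton.elim x 0]
      simp [dH]
    simp [hd, Real.zero_rpow hα', Real.zero_rpow hα'']
  have hφ : ContDiff ℝ 1 φ := hφ_smooth.of_le (by exact_mod_cast le_top)
  obtain ⟨b, hb0, hb1, hbR, hsupp⟩ :=
    exists_subset_ball_of_subset_hypBall hR (isClosed_tsupport φ) hφ_supp
  have hφ0 : ∀ x, x ∉ hypBall (m + 1) R → φ x = 0 := fun x hx ↦
    image_eq_zero_of_notMem_tsupport fun h ↦ hx (hφ_supp h)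
  have hg0 : ∀ x, x ∉ hypBall (m + 1) R → gradient φ x = 0 := fun x hx ↦ by
    rw [← norm_eq_zero, norm_gradient, norm_eq_zero]
    exact image_eq_zero_of_notMem_tsupport fun h ↦ hx (hφ_supp (tsupport_fderiv_subset ℝ h))
  rw [setIntegral_eq_integral_of_forall_compl_eq_zero fun x hx ↦ by simp [hφ0 x hx],
    setIntegral_eq_integral_of_forall_compl_eq_zero fun x hx ↦ by simp [hφ0 x hx],
    setIntegral_eq_integral_of_forall_compl_eq_zero fun x hx ↦ by simp [hg0 x hx],
    ← integral_const_mul, ← integral_const_mul]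
  have hd := measurable_dH (n := m + 1)
  have hl := measurable_lam (n := m + 1)
  have hφm := hφ.continuous.measurable
  have hgm := (continuous_gradient hφ).measurable
  have hpos : ∀ x : EuclideanSpace ℝ (Fin (m + 1)), ‖x‖ < b → 0 ≤ dH x ∧ 0 < lam x := fun x hx ↦
    ⟨by linarith [two_mul_le_radialDist (norm_nonneg x) (hx.trans hb1), norm_nonneg x, dH_eq x],
      radialLam_pos (norm_nonneg x) (hx.trans hb1)⟩
  have hle := lintegral_hardy_le hα hφ hb1 hbR hsupp
  set c := (((m + 1 : ℕ) : ℝ) + α - 2) / 2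
  set f₁ := fun x ↦ dH x ^ (α - 2) * φ x ^ 2 * lam x ^ ((m + 1 : ℕ) : ℝ) with hf₁
  set f₂ := fun x ↦ dH x ^ α * (φ x ^ 2 / (R - dH x) ^ 2) * lam x ^ ((m + 1 : ℕ) : ℝ) with hf₂
  set q := fun x ↦ dH x ^ α * ‖gradient φ x‖ ^ 2 * lam x ^ (((m + 1 : ℕ) : ℝ) - 2) with hq
  have hm₁ : Measurable f₁ := by fun_prop
  have hm₂ : Measurable f₂ := by fun_prop
  have h₁ : ∀ x, 0 ≤ f₁ x := fun x ↦ by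
    rcases le_or_gt b ‖x‖ with hx | hx
    · simp [hf₁, eq_zero_of_le_norm hsupp hx]
    · obtain ⟨_, _⟩ := hpos x hx
      simp only [hf₁]
      positivity
  have h₂ : ∀ x, 0 ≤ f₂ x := fun x ↦ by
    rcases le_or_gt b ‖x‖ with hx | hx
    · simp [hf₂, eq_zero_of_le_norm hsupp hx]
    · obtain ⟨_, _⟩ := hpos x hx
      simp only [hf₂]
      positivity
  have hq0 : ∀ x, 0 ≤ q x := fun x ↦ by
    rcases le_or_gt b ‖x‖ with hx | hx
    · simp [hq, gradient_eq_zero_of_le_norm hsupp hx]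
    · obtain ⟨_, _⟩ := hpos x hx
      simp only [hq]
      positivity
  have hqint : Integrable q := by
    simp only [hq, mul_assoc]
    refine integrable_dH_rpow_mul (by linarith) hb1 (by fun_prop) ?_ fun x hx ↦ by
      simp [gradient_eq_zero_of_le_norm hsupp hx]
    have hsub : MapsTo (fun x : EuclideanSpace ℝ (Fin (m + 1)) ↦ ‖x‖) (closedBall 0 b) (Ico 0 1) :=
      fun x hx ↦ ⟨norm_nonneg x, (mem_closedBall_zero_iff.1 hx).trans_lt hb1⟩
    exact ((continuous_gradient hφ).norm.pow 2).continuousOn.mul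
      ((continuousOn_radialLam.comp continuous_norm.continuousOn hsub).rpow_const fun x hx ↦
        .inl (radialLam_pos (hsub hx).1 (hsub hx).2).ne')
  have hp0 : ∀ x, 0 ≤ c ^ 2 * f₁ x + 1 / 4 * f₂ x := fun x ↦
    add_nonneg (mul_nonneg (sq_nonneg c) (h₁ x)) (mul_nonneg (by norm_num) (h₂ x))
  have hqfin : ∫⁻ x, ENNReal.ofReal (q x) ≠ ⊤ := hqint.lintegral_lt_top.ne
  have hpm : AEStronglyMeasurable (fun x ↦ c ^ 2 * f₁ x + 1 / 4 * f₂ x) volume :=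
    (by fun_prop : Measurable _).aestronglyMeasurable
  have hpint : Integrable fun x ↦ c ^ 2 * f₁ x + 1 / 4 * f₂ x :=
    (lintegral_ofReal_ne_top_iff_integrable hpm (.of_forall hp0)).1
      (ne_top_of_le_ne_top hqfin hle)
  have hi₁ : Integrable fun x ↦ c ^ 2 * f₁ x :=
    hpint.mono' (by fun_prop : Measurable _).aestronglyMeasurable <| .of_forall fun x ↦ by
      rw [Real.norm_of_nonneg (mul_nonneg (sq_nonneg c) (h₁ x))]
      linarith [h₂ x]
  have hi₂ : Integrable fun x ↦ 1 / 4 * f₂ x :=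
    hpint.mono' (by fun_prop : Measurable _).aestronglyMeasurable <| .of_forall fun x ↦ by
      rw [Real.norm_of_nonneg (mul_nonneg (by norm_num) (h₂ x))]
      linarith [mul_nonneg (sq_nonneg c) (h₁ x)]
  rw [← integral_add hi₁ hi₂, integral_eq_lintegral_of_nonneg_ae (.of_forall hp0) hpm,
    integral_eq_lintegral_of_nonneg_ae (.of_forall hq0) hqint.aestronglyMeasurable]
  exact ENNReal.toReal_mono hqfin hle
end

section
/- Let n ≥ 3, 0 ≤ s ≤ 2 and p*(s) = 2(n - s)/(n - 2). Then for every φ ∈ C_c^∞(B), ∫_B |∇φ|² λ^{n-2} dx ≥ ((n-2)/2)^{2s/p*(s)} · ( (n(n-2)/4) |𝕊ⁿ|^{2/n} )^{n(2-s)/(2(n-s))} · ( ∫_B d^{-s} |φ|^{p*(s)} λ^n dx )^{2/p*(s)}, where |𝕊ⁿ| denotes the volume (surface measure) of the unit n-dimensional sphere in ℝ^{n+1}. -/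
open MeasureTheory

/-- The volume `|𝕊ⁿ|` of the unit `n`-sphere in `ℝ^{n+1}`, expressed as
`(n+1)` times the volume of the unit ball of `ℝ^{n+1}`. -/
noncomputable def sphereVol (n : ℕ) : ℝ :=
  (n + 1) * (volume (Metric.ball (0 : EuclideanSpace ℝ (Fin (n + 1))) 1)).toReal

/-- Cumulative distribution function of a positive continuous density. -/
theorem hasDerivAt_integral_Iic {f : ℝ → ℝ} (hc : Continuous f) (hi : Integrable f) (x : ℝ) :
    HasDerivAt (fun y => ∫ t in Set.Iic y, f t) (f x) x := by
  have h : (fun y => ∫ t in Set.Iic y, f t)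
      = fun y => (∫ t in Set.Iic (0 : ℝ), f t) + ∫ t in (0 : ℝ)..y, f t := by
    funext y
    rw [← intervalIntegral.integral_Iic_sub_Iic hi.integrableOn hi.integrableOn]
    ring
  rw [h]
  exact (intervalIntegral.integral_hasDerivAt_right (hc.intervalIntegrable _ _)
    (hc.stronglyMeasurableAtFilter _ _) hc.continuousAt).const_add _

theorem strictMono_integral_Iic {f : ℝ → ℝ} (hc : Continuous f) (hi : Integrable f)
    (hp : ∀ x, 0 < f x) : StrictMono fun y => ∫ t in Set.Iic y, f t :=
  strictMono_of_hasDerivAt_pos (hasDerivAt_integral_Iic hc hi) hp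

theorem tendsto_integral_Iic_atTop {f : ℝ → ℝ} (hi : Integrable f) :
    Filter.Tendsto (fun y => ∫ t in Set.Iic y, f t) Filter.atTop (nhds (∫ t, f t)) := by
  have :=
    (aecover_Iic (μ := volume) (Filter.tendsto_id (α := ℝ))).integral_tendsto_of_countably_generated
      hi
  simpa using this

theorem tendsto_integral_Iic_atBot {f : ℝ → ℝ} (hi : Integrable f) :
    Filter.Tendsto (fun y => ∫ t in Set.Iic y, f t) Filter.atBot (nhds 0) := by
  have h := (aecover_Ioi (μ := volume)
    (Filter.tendsto_id (x := Filter.atBot (α := ℝ)))).integral_tendsto_of_countably_generated hi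
  have h2 : (fun y => ∫ t in Set.Iic y, f t) = fun y => (∫ t, f t) - ∫ t in Set.Ioi y, f t := by
    funext y
    rw [← intervalIntegral.integral_Iic_add_Ioi (b := y) hi.integrableOn hi.integrableOn]
    ring
  rw [h2]
  simpa using h.const_sub (∫ t, f t)

theorem range_integral_Iic {f : ℝ → ℝ} (hc : Continuous f) (hi : Integrable f)
    (hp : ∀ x, 0 < f x) :
    Set.range (fun y => ∫ t in Set.Iic y, f t) = Set.Ioo 0 (∫ t, f t) := by
  have hm := strictMono_integral_Iic hc hi hp
  apply Set.Subset.antisymm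
  · rintro _ ⟨y, rfl⟩
    constructor
    · exact (le_of_tendsto (tendsto_integral_Iic_atBot hi)
        ((Filter.eventually_le_atBot (y - 1)).mono fun z hz => hm.monotone hz)).trans_lt
          (hm (by linarith : y - 1 < y))
    · exact (hm (by linarith : y < y + 1)).trans_le
        (ge_of_tendsto (tendsto_integral_Iic_atTop hi)
          ((Filter.eventually_ge_atTop (y + 1)).mono fun z hz => hm.monotone hz))
  · intro z hz
    obtain ⟨a, ha⟩ := ((tendsto_integral_Iic_atBot hi).eventually_lt_const hz.1).exists
    obtain ⟨b, hb⟩ := ((tendsto_integral_Iic_atTop hi).eventually_const_lt hz.2).exists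
    have hcont : Continuous (fun y => ∫ t in Set.Iic y, f t) :=
      continuous_iff_continuousAt.2 fun x => (hasDerivAt_integral_Iic hc hi x).continuousAt
    exact mem_range_of_exists_le_of_exists_ge hcont ⟨a, ha.le⟩ ⟨b, hb.le⟩

/-- Monotone transport between two positive continuous densities on the line, depending measurably
on a parameter. -/
theorem exists_monotone_transport {Ω : Type*} [MeasurableSpace Ω] (ρ σ : Ω → ℝ → ℝ)
    (hρm : Measurable (Function.uncurry ρ)) (hσm : Measurable (Function.uncurry σ))
    (hρc : ∀ ω, Continuous (ρ ω)) (hσc : ∀ ω, Continuous (σ ω))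
    (hρp : ∀ ω x, 0 < ρ ω x) (hσp : ∀ ω x, 0 < σ ω x)
    (hρi : ∀ ω, Integrable (ρ ω)) (hσi : ∀ ω, Integrable (σ ω))
    (hmass : ∀ ω, ∫ x, ρ ω x = ∫ x, σ ω x) :
    ∃ T : Ω → ℝ → ℝ, Measurable (Function.uncurry T) ∧
      (∀ ω x, HasDerivAt (T ω) (ρ ω x / σ ω (T ω x)) x) ∧
      ∀ ω (h : ℝ → ENNReal),
        ∫⁻ x, h (T ω x) * ENNReal.ofReal (ρ ω x) = ∫⁻ y, h y * ENNReal.ofReal (σ ω y) := by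
  have hex : ∀ ω x, ∃ y, ∫ t in Set.Iic y, σ ω t = ∫ t in Set.Iic x, ρ ω t := by
    intro ω x
    have : (∫ t in Set.Iic x, ρ ω t) ∈ Set.range (fun y => ∫ t in Set.Iic y, ρ ω t) := ⟨x, rfl⟩
    rw [range_integral_Iic (hρc ω) (hρi ω) (hρp ω), hmass ω,
      ← range_integral_Iic (hσc ω) (hσi ω) (hσp ω)] at this
    exact this
  choose T hT using hex
  have hF := fun ω => strictMono_integral_Iic (hρc ω) (hρi ω) (hρp ω)
  have hG := fun ω => strictMono_integral_Iic (hσc ω) (hσi ω) (hσp ω)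
  have hTmono : ∀ ω, StrictMono (T ω) := by
    intro ω x y hxy
    rw [← (hG ω).lt_iff_lt, hT, hT]
    exact hF ω hxy
  have hTsurj : ∀ ω, Function.Surjective (T ω) := by
    intro ω y
    have : (∫ t in Set.Iic y, σ ω t) ∈ Set.range (fun y => ∫ t in Set.Iic y, σ ω t) := ⟨y, rfl⟩
    rw [range_integral_Iic (hσc ω) (hσi ω) (hσp ω), ← hmass ω,
      ← range_integral_Iic (hρc ω) (hρi ω) (hρp ω)] at this
    obtain ⟨x, hx⟩ := this
    exact ⟨x, (hG ω).injective ((hT ω x).trans hx)⟩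
  have hTcont : ∀ ω, Continuous (T ω) := fun ω =>
    (hTmono ω).monotone.continuous_of_surjective (hTsurj ω)
  have hTder : ∀ ω x, HasDerivAt (T ω) (ρ ω x / σ ω (T ω x)) x := by
    intro ω x
    rw [hasDerivAt_iff_tendsto_slope]
    have h1 := hasDerivAt_iff_tendsto_slope.1 (hasDerivAt_integral_Iic (hρc ω) (hρi ω) x)
    have h2 := hasDerivAt_iff_tendsto_slope.1 (hasDerivAt_integral_Iic (hσc ω) (hσi ω) (T ω x))
    have h3 : Filter.Tendsto (T ω) (nhdsWithin x {x}ᶜ) (nhdsWithin (T ω x) {T ω x}ᶜ) := by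
      refine tendsto_nhdsWithin_of_tendsto_nhds_of_eventually_within _
        ((hTcont ω).continuousAt.tendsto.mono_left nhdsWithin_le_nhds) ?_
      filter_upwards [self_mem_nhdsWithin] with y hy
      exact fun h => hy ((hTmono ω).injective h)
    refine (h1.div (h2.comp h3) (hσp ω _).ne').congr' ?_
    filter_upwards [self_mem_nhdsWithin] with y hy
    have hy' : y - x ≠ 0 := sub_ne_zero.2 hy
    have hTy : T ω y - T ω x ≠ 0 := sub_ne_zero.2 fun h => hy ((hTmono ω).injective h)
    have hFy : (∫ t in Set.Iic y, ρ ω t) - ∫ t in Set.Iic x, ρ ω t ≠ 0 :=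
      sub_ne_zero.2 fun h => hy ((hF ω).injective h)
    simp only [Pi.div_apply, Function.comp, slope_def_field, hT]
    field_simp
  have hcdf : ∀ τ : Ω → ℝ → ℝ, Measurable (Function.uncurry τ) →
      Measurable fun p : Ω × ℝ => ∫ t in Set.Iic p.2, τ p.1 t := by
    intro τ hτ
    have h : Measurable fun q : (Ω × ℝ) × ℝ => (Set.Iic q.1.2).indicator (τ q.1.1) q.2 := by
      have hs : MeasurableSet {q : (Ω × ℝ) × ℝ | q.2 ≤ q.1.2} :=
        measurableSet_le measurable_snd (measurable_snd.comp measurable_fst)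
      exact (hτ.comp ((measurable_fst.comp measurable_fst).prodMk measurable_snd)).indicator hs
    have := (StronglyMeasurable.integral_prod_right (ν := volume)
      (f := fun (p : Ω × ℝ) t => (Set.Iic p.2).indicator (τ p.1) t) h.stronglyMeasurable).measurable
    simpa only [integral_indicator measurableSet_Iic] using this
  refine ⟨T, ?_, hTder, ?_⟩
  · refine measurable_of_Iio fun a => ?_
    have : Function.uncurry T ⁻¹' Set.Iio a
        = {p : Ω × ℝ | (∫ t in Set.Iic p.2, ρ p.1 t) < ∫ t in Set.Iic a, σ p.1 t} := by
      ext ⟨ω, x⟩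
      simp only [Set.mem_preimage, Function.uncurry, Set.mem_Iio, Set.mem_ofPred_eq]
      rw [← hT, (hG ω).lt_iff_lt]
    rw [this]
    exact measurableSet_lt (hcdf ρ hρm)
      ((hcdf σ hσm).comp (measurable_fst.prodMk (measurable_const (a := a))))
  · intro ω h
    have := lintegral_image_eq_lintegral_abs_deriv_mul MeasurableSet.univ
      (fun x _ => (hTder ω x).hasDerivWithinAt) (hTmono ω).injective.injOn
      (fun y => h y * ENNReal.ofReal (σ ω y))
    rw [Set.image_univ, (hTsurj ω).range_eq] at this
    simp only [Measure.restrict_univ] at this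
    rw [this]
    congr 1
    funext x
    have h1 : 0 < ρ ω x / σ ω (T ω x) := div_pos (hρp _ _) (hσp _ _)
    rw [abs_of_pos h1, mul_left_comm, ← ENNReal.ofReal_mul h1.le, div_mul_cancel₀ _ (hσp _ _).ne']

theorem lintegral_fin_cons {n : ℕ} {F : (Fin (n + 1) → ℝ) → ENNReal} (hF : Measurable F) :
    ∫⁻ x, F x = ∫⁻ t : ℝ, ∫⁻ y : Fin n → ℝ, F (Fin.cons t y) := by
  have h := (volume_preserving_piFinSuccAbove (fun _ : Fin (n + 1) => ℝ) 0).symm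
  rw [← h.lintegral_comp hF, Measure.volume_eq_prod, lintegral_prod]
  · simp [MeasurableEquiv.piFinSuccAbove, Fin.insertNthEquiv]
  · exact (hF.comp (MeasurableEquiv.measurable _)).aemeasurable

theorem integral_fin_cons {n : ℕ} {F : (Fin (n + 1) → ℝ) → ℝ} (hF : Integrable F) :
    ∫ x, F x = ∫ t : ℝ, ∫ y : Fin n → ℝ, F (Fin.cons t y) := by
  have h := (volume_preserving_piFinSuccAbove (fun _ : Fin (n + 1) => ℝ) 0).symm
  rw [← h.integral_comp (MeasurableEquiv.measurableEmbedding _), Measure.volume_eq_prod,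
    integral_prod]
  · simp [MeasurableEquiv.piFinSuccAbove, Fin.insertNthEquiv]
  · exact h.integrable_comp_of_integrable hF

theorem integrable_prod_inv_one_add_sq (n : ℕ) :
    Integrable fun x : Fin n → ℝ => ∏ i, (1 + x i ^ 2)⁻¹ :=
  Integrable.fintype_prod (f := fun _ t => (1 + t ^ 2)⁻¹) fun _ => integrable_inv_one_add_sq

theorem measurable_fin_cons {n : ℕ} :
    Measurable fun p : ℝ × (Fin n → ℝ) => (Fin.cons p.1 p.2 : Fin (n + 1) → ℝ) := by
  refine measurable_pi_iff.2 fun i => ?_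
  refine Fin.cases ?_ (fun j => ?_) i
  · simpa using measurable_fst
  · simpa [Function.comp_def] using (measurable_pi_apply j).comp measurable_snd

section marginal

variable {n : ℕ} {f : (Fin (n + 1) → ℝ) → ℝ} {C : ℝ}

theorem apply_cons_le (hb : ∀ x, f x ≤ C * ∏ i, (1 + x i ^ 2)⁻¹) (t : ℝ) (y : Fin n → ℝ) :
    f (Fin.cons t y) ≤ (C * (1 + t ^ 2)⁻¹) * ∏ i, (1 + y i ^ 2)⁻¹ := by
  have := hb (Fin.cons t y)
  rw [Fin.prod_univ_succ] at this
  simpa [mul_assoc] using this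

theorem continuous_cons (hc : Continuous f) (t : ℝ) :
    Continuous fun y : Fin n → ℝ => f (Fin.cons t y) :=
  hc.comp (continuous_const.finCons continuous_id)

theorem integrable_of_le_prod {n : ℕ} {f : (Fin n → ℝ) → ℝ} {C : ℝ} (hc : Continuous f)
    (hp : ∀ x, 0 < f x) (hb : ∀ x, f x ≤ C * ∏ i, (1 + x i ^ 2)⁻¹) : Integrable f := by
  refine ((integrable_prod_inv_one_add_sq n).const_mul C).mono' hc.aestronglyMeasurable ?_
  exact Filter.Eventually.of_forall fun x => by
    rw [Real.norm_of_nonneg (hp x).le]; exact hb x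

theorem integral_pos_of_pos {n : ℕ} {f : (Fin n → ℝ) → ℝ} (hi : Integrable f)
    (hp : ∀ x, 0 < f x) : 0 < ∫ x, f x := by
  rw [integral_pos_iff_support_of_nonneg (fun x => (hp x).le) hi]
  have : Function.support f = Set.univ := Set.eq_univ_of_forall fun x => (hp x).ne'
  rw [this]
  exact Measure.measure_univ_pos.2 (NeZero.ne _)

theorem integrable_cons (hc : Continuous f)
    (hp : ∀ x, 0 < f x) (hb : ∀ x, f x ≤ C * ∏ i, (1 + x i ^ 2)⁻¹) (t : ℝ) :
    Integrable fun y : Fin n → ℝ => f (Fin.cons t y) :=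
  integrable_of_le_prod (continuous_cons hc t) (fun _ => hp _) (apply_cons_le hb t)

theorem const_nonneg_of_le (hp : ∀ x, 0 < f x) (hb : ∀ x, f x ≤ C * ∏ i, (1 + x i ^ 2)⁻¹) :
    0 ≤ C := by
  have := (hp 0).le.trans (hb 0)
  simpa using this

theorem continuous_marginal (hc : Continuous f)
    (hp : ∀ x, 0 < f x) (hb : ∀ x, f x ≤ C * ∏ i, (1 + x i ^ 2)⁻¹) :
    Continuous fun t : ℝ => ∫ y : Fin n → ℝ, f (Fin.cons t y) := by
  refine continuous_of_dominated (bound := fun y => C * ∏ i, (1 + y i ^ 2)⁻¹)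
    (fun t => (continuous_cons hc t).aestronglyMeasurable) (fun t => ?_)
    ((integrable_prod_inv_one_add_sq n).const_mul C) ?_
  · refine Filter.Eventually.of_forall fun y => ?_
    rw [Real.norm_of_nonneg (hp _).le]
    refine (apply_cons_le hb t y).trans ?_
    have h0 := const_nonneg_of_le hp hb
    have h1 : (1 + t ^ 2)⁻¹ ≤ 1 := inv_le_one_of_one_le₀ (by nlinarith [sq_nonneg t])
    have h2 : 0 ≤ ∏ i, (1 + y i ^ 2)⁻¹ := Finset.prod_nonneg fun i _ => by positivity
    exact mul_le_mul_of_nonneg_right (mul_le_of_le_one_right h0 h1) h2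
  · refine Filter.Eventually.of_forall fun y => hc.comp ?_
    refine continuous_pi fun i => ?_
    refine Fin.cases ?_ (fun j => ?_) i
    · simpa using continuous_id'
    · simpa using continuous_const

theorem integrable_marginal (hc : Continuous f)
    (hp : ∀ x, 0 < f x) (hb : ∀ x, f x ≤ C * ∏ i, (1 + x i ^ 2)⁻¹) :
    Integrable fun t : ℝ => ∫ y : Fin n → ℝ, f (Fin.cons t y) := by
  refine (integrable_inv_one_add_sq.const_mul
    (C * ∫ y : Fin n → ℝ, ∏ i, (1 + y i ^ 2)⁻¹)).mono'
    (continuous_marginal hc hp hb).aestronglyMeasurable ?_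
  refine Filter.Eventually.of_forall fun t => ?_
  rw [Real.norm_of_nonneg (integral_nonneg fun y => (hp _).le)]
  calc ∫ y : Fin n → ℝ, f (Fin.cons t y)
      ≤ ∫ y : Fin n → ℝ, (C * (1 + t ^ 2)⁻¹) * ∏ i, (1 + y i ^ 2)⁻¹ :=
        integral_mono (integrable_cons hc hp hb t)
          ((integrable_prod_inv_one_add_sq n).const_mul _) (apply_cons_le hb t)
    _ = _ := by rw [integral_const_mul]; ring

end marginal

/-- The Knothe map between two positive continuous densities with the same mass, depending
measurably on a parameter. Only the diagonal partial derivatives of the map are controlled. -/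
theorem exists_knothe_map (n : ℕ) : ∀ {Ω : Type} [MeasurableSpace Ω]
    (ρ σ : Ω → (Fin n → ℝ) → ℝ),
    Measurable (Function.uncurry ρ) → Measurable (Function.uncurry σ) →
    (∀ ω, Continuous (ρ ω)) → (∀ ω, Continuous (σ ω)) →
    (∀ ω x, 0 < ρ ω x) → (∀ ω x, 0 < σ ω x) →
    (∀ ω, ∃ C, ∀ x, ρ ω x ≤ C * ∏ i, (1 + x i ^ 2)⁻¹) →
    (∀ ω, ∃ C, ∀ x, σ ω x ≤ C * ∏ i, (1 + x i ^ 2)⁻¹) →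
    (∀ ω, ∫ x, ρ ω x = ∫ x, σ ω x) →
    ∃ (T : Ω → (Fin n → ℝ) → Fin n → ℝ) (a : Ω → (Fin n → ℝ) → Fin n → ℝ),
      Measurable (Function.uncurry T) ∧ (∀ ω x i, 0 < a ω x i) ∧
      (∀ ω x i, HasDerivAt (fun t => T ω (Function.update x i t) i) (a ω x i) (x i)) ∧
      (∀ ω x, (∏ i, a ω x i) * σ ω (T ω x) = ρ ω x) ∧
      ∀ ω (h : (Fin n → ℝ) → ENNReal), Measurable h →
        ∫⁻ x, h (T ω x) * ENNReal.ofReal (ρ ω x) = ∫⁻ y, h y * ENNReal.ofReal (σ ω y) := by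
  induction n with
  | zero =>
    intro Ω _ ρ σ hρm hσm hρc hσc hρp hσp hρb hσb hmass
    refine ⟨fun _ x => x, fun _ _ _ => 1, measurable_snd, fun _ _ i => i.elim0,
      fun _ _ i => i.elim0, fun ω x => ?_, fun ω h _ => ?_⟩ <;>
    have h1 : ρ ω = σ ω := by
      have := hmass ω
      simp only [integral_unique, Measure.real, volume_pi] at this
      simp at this
      funext y
      rwa [Subsingleton.elim y (@default _ Unique.instInhabited)]
    · simp [h1]
    · simp [h1]
  | succ n ih =>
    intro Ω _ ρ σ hρm hσm hρc hσc hρp hσp hρb hσb hmass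
    choose Cρ hCρ using hρb
    choose Cσ hCσ using hσb
    have hcons : Measurable fun q : (Ω × ℝ) × (Fin n → ℝ) =>
        (q.1.1, (Fin.cons q.1.2 q.2 : Fin (n + 1) → ℝ)) :=
      (measurable_fst.comp measurable_fst).prodMk (measurable_fin_cons.comp
        ((measurable_snd.comp measurable_fst).prodMk measurable_snd))
    set ρ₁ : Ω → ℝ → ℝ := fun ω t => ∫ y : Fin n → ℝ, ρ ω (Fin.cons t y) with hρ₁
    set σ₁ : Ω → ℝ → ℝ := fun ω t => ∫ y : Fin n → ℝ, σ ω (Fin.cons t y) with hσ₁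
    have hρ₁m : Measurable (Function.uncurry ρ₁) :=
      (StronglyMeasurable.integral_prod_right (ν := volume)
        (f := fun (p : Ω × ℝ) (y : Fin n → ℝ) => ρ p.1 (Fin.cons p.2 y))
        (hρm.comp hcons).stronglyMeasurable).measurable
    have hσ₁m : Measurable (Function.uncurry σ₁) :=
      (StronglyMeasurable.integral_prod_right (ν := volume)
        (f := fun (p : Ω × ℝ) (y : Fin n → ℝ) => σ p.1 (Fin.cons p.2 y))
        (hσm.comp hcons).stronglyMeasurable).measurable
    have hρ₁p : ∀ ω t, 0 < ρ₁ ω t := fun ω t =>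
      integral_pos_of_pos (integrable_cons (hρc ω) (hρp ω) (hCρ ω) t) fun _ => hρp _ _
    have hσ₁p : ∀ ω t, 0 < σ₁ ω t := fun ω t =>
      integral_pos_of_pos (integrable_cons (hσc ω) (hσp ω) (hCσ ω) t) fun _ => hσp _ _
    obtain ⟨S, hSm, hSd, hSpush⟩ := exists_monotone_transport ρ₁ σ₁ hρ₁m hσ₁m
      (fun ω => continuous_marginal (hρc ω) (hρp ω) (hCρ ω))
      (fun ω => continuous_marginal (hσc ω) (hσp ω) (hCσ ω)) hρ₁p hσ₁p
      (fun ω => integrable_marginal (hρc ω) (hρp ω) (hCρ ω))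
      (fun ω => integrable_marginal (hσc ω) (hσp ω) (hCσ ω))
      (fun ω => by
        rw [hρ₁, hσ₁]
        simp only
        rw [← integral_fin_cons (integrable_of_le_prod (hρc ω) (hρp ω) (hCρ ω)),
          ← integral_fin_cons (integrable_of_le_prod (hσc ω) (hσp ω) (hCσ ω)), hmass ω])
    have hSm' : Measurable fun p : Ω × ℝ => S p.1 p.2 := hSm
    set r : Ω × ℝ → ℝ := fun p => ρ₁ p.1 p.2 / σ₁ p.1 (S p.1 p.2) with hr
    have hrp : ∀ p, 0 < r p := fun p => div_pos (hρ₁p _ _) (hσ₁p _ _)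
    have hrm : Measurable r := hρ₁m.div (hσ₁m.comp (measurable_fst.prodMk hSm'))
    obtain ⟨T', a', hT'm, ha'p, hT'd, hT'prod, hT'push⟩ := ih
      (fun (p : Ω × ℝ) y => ρ p.1 (Fin.cons p.2 y))
      (fun (p : Ω × ℝ) y => r p * σ p.1 (Fin.cons (S p.1 p.2) y))
      (hρm.comp hcons)
      ((hrm.comp measurable_fst).mul (hσm.comp (hcons.comp
        (((measurable_fst.comp measurable_fst).prodMk (hSm'.comp measurable_fst)).prodMk
          measurable_snd))))
      (fun p => continuous_cons (hρc p.1) p.2)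
      (fun p => (continuous_cons (hσc p.1) _).const_mul _)
      (fun p y => hρp _ _) (fun p y => mul_pos (hrp p) (hσp _ _))
      (fun p => ⟨_, apply_cons_le (hCρ p.1) p.2⟩)
      (fun p => ⟨r p * (Cσ p.1 * (1 + S p.1 p.2 ^ 2)⁻¹), fun y => by
        rw [mul_assoc]
        exact mul_le_mul_of_nonneg_left (apply_cons_le (hCσ p.1) _ y) (hrp p).le⟩)
      (fun p => by
        rw [integral_const_mul]
        change ρ₁ p.1 p.2 = ρ₁ p.1 p.2 / σ₁ p.1 (S p.1 p.2) * σ₁ p.1 (S p.1 p.2)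
        rw [div_mul_cancel₀ _ (hσ₁p _ _).ne'])
    have hT'm' : Measurable fun q : (Ω × ℝ) × (Fin n → ℝ) => T' q.1 q.2 := hT'm
    have htail : Measurable fun x : Fin (n + 1) → ℝ => Fin.tail x :=
      measurable_pi_iff.2 fun i => measurable_pi_apply _
    have hTm : Measurable fun p : Ω × (Fin (n + 1) → ℝ) =>
        (Fin.cons (S p.1 (p.2 0)) (T' (p.1, p.2 0) (Fin.tail p.2)) : Fin (n + 1) → ℝ) := by
      have h0 : Measurable fun p : Ω × (Fin (n + 1) → ℝ) => (p.1, p.2 0) :=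
        measurable_fst.prodMk ((measurable_pi_apply 0).comp measurable_snd)
      exact measurable_fin_cons.comp ((hSm'.comp h0).prodMk
        (hT'm'.comp (h0.prodMk (htail.comp measurable_snd))))
    refine ⟨fun ω x => Fin.cons (S ω (x 0)) (T' (ω, x 0) (Fin.tail x)),
      fun ω x => Fin.cons (r (ω, x 0)) (a' (ω, x 0) (Fin.tail x)), hTm, ?_, ?_, ?_, ?_⟩
    · intro ω x i
      refine Fin.cases ?_ (fun j => ?_) i
      · simpa using hrp _
      · simpa using ha'p _ _ j
    · intro ω x i
      refine Fin.cases ?_ (fun j => ?_) i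
      · simpa using hSd ω (x 0)
      · have := hT'd (ω, x 0) (Fin.tail x) j
        simpa [Fin.tail_update_succ, Fin.tail, Function.update_of_ne (Fin.succ_ne_zero j).symm]
          using this
    · intro ω x
      have h1 := hT'prod (ω, x 0) (Fin.tail x)
      simp only [Fin.cons_self_tail] at h1
      rw [Fin.prod_univ_succ]
      simp only [Fin.cons_zero, Fin.cons_succ]
      rw [← h1]
      ring
    · intro ω h hh
      have hmeas1 : Measurable fun x : Fin (n + 1) → ℝ =>
          h (Fin.cons (S ω (x 0)) (T' (ω, x 0) (Fin.tail x))) * ENNReal.ofReal (ρ ω x) :=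
        (hh.comp (hTm.comp (measurable_const.prodMk measurable_id))).mul
          (hρc ω).measurable.ennreal_ofReal
      have hmeas2 : Measurable fun x : Fin (n + 1) → ℝ => h x * ENNReal.ofReal (σ ω x) :=
        hh.mul (hσc ω).measurable.ennreal_ofReal
      rw [lintegral_fin_cons hmeas1, lintegral_fin_cons hmeas2]
      set H : ℝ → ENNReal := fun s =>
        (∫⁻ y : Fin n → ℝ, h (Fin.cons s y) * ENNReal.ofReal (σ ω (Fin.cons s y)))
          * ENNReal.ofReal (σ₁ ω s)⁻¹ with hH
      have key : ∀ s, (∫⁻ y : Fin n → ℝ, h (Fin.cons s y) * ENNReal.ofReal (σ ω (Fin.cons s y)))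
          = H s * ENNReal.ofReal (σ₁ ω s) := by
        intro s
        rw [hH]
        simp only
        rw [mul_assoc, ← ENNReal.ofReal_mul (inv_nonneg.2 (hσ₁p _ _).le),
          inv_mul_cancel₀ (hσ₁p _ _).ne', ENNReal.ofReal_one, mul_one]
      simp_rw [key]
      rw [← hSpush ω H]
      congr 1
      funext t
      simp only [Fin.cons_zero, Fin.tail_cons]
      have hms : Measurable fun y : Fin n → ℝ => h (Fin.cons (S ω t) y) :=
        hh.comp (measurable_fin_cons.comp (measurable_const.prodMk measurable_id))
      have := hT'push (ω, t) (fun y => h (Fin.cons (S ω t) y)) hms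
      simp only at this
      rw [this]
      have hms2 : Measurable fun y : Fin n → ℝ =>
          h (Fin.cons (S ω t) y) * ENNReal.ofReal (σ ω (Fin.cons (S ω t) y)) :=
        hms.mul (continuous_cons (hσc ω) _).measurable.ennreal_ofReal
      calc ∫⁻ y : Fin n → ℝ, h (Fin.cons (S ω t) y) *
            ENNReal.ofReal (r (ω, t) * σ ω (Fin.cons (S ω t) y))
          = ∫⁻ y : Fin n → ℝ, ENNReal.ofReal (r (ω, t)) * (h (Fin.cons (S ω t) y) *
            ENNReal.ofReal (σ ω (Fin.cons (S ω t) y))) := by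
            congr 1
            funext y
            rw [ENNReal.ofReal_mul (hrp _).le, mul_left_comm]
        _ = _ := by
            rw [lintegral_const_mul _ hms2, hH, hr]
            simp only
            rw [mul_assoc, ← ENNReal.ofReal_mul (inv_nonneg.2 (hσ₁p _ _).le), mul_comm]
            congr 2
            ring

theorem HasLineDerivAt.hasDerivAt_add_smul {E : Type*} [NormedAddCommGroup E] [NormedSpace ℝ E]
    {f f' : E → ℝ} {v : E} (h : ∀ x, HasLineDerivAt ℝ f (f' x) x v) (x : E) (t : ℝ) :
    HasDerivAt (fun s : ℝ => f (x + s • v)) (f' (x + t • v)) t := by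
  have h1 : HasDerivAt (fun s : ℝ => f (x + t • v + s • v)) (f' (x + t • v)) (t - t) := by
    rw [sub_self]; exact h (x + t • v)
  have h2 := h1.comp_sub_const t t
  refine h2.congr_of_eventuallyEq (Filter.Eventually.of_forall fun s => ?_)
  simp only
  congr 1
  module

section LineDeriv

variable {E : Type*} [NormedAddCommGroup E] [NormedSpace ℝ E] [MeasurableSpace E] [BorelSpace E]
  [FiniteDimensional ℝ E] {μ : Measure E} [μ.IsAddHaarMeasure]

/-- One-sided integration by parts for a function which is monotone along a direction: no
integrability of the derivative is assumed. -/
theorem integral_mul_lineDeriv_le {w f f' : E → ℝ} {v : E}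
    (hw : ContDiff ℝ 1 w) (hwc : HasCompactSupport w) (hw0 : ∀ x, 0 ≤ w x)
    (hfm : Measurable f) (hfi : LocallyIntegrable f μ) (hf'0 : ∀ x, 0 ≤ f' x)
    (hf : ∀ x, HasLineDerivAt ℝ f (f' x) x v) :
    Integrable (fun x => w x * f' x) μ ∧
      ∫ x, w x * f' x ∂μ ≤ -∫ x, fderiv ℝ w x v * f x ∂μ := by
  set h : ℕ → ℝ := fun k => 1 / ((k : ℝ) + 1) with hh
  have hpos : ∀ k, 0 < h k := fun k => Nat.one_div_pos_of_nat
  have hle : ∀ k, h k ≤ 1 := fun k => by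
    rw [hh]; simp only
    rw [div_le_one (by positivity)]
    have : (0 : ℝ) ≤ k := by positivity
    linarith
  have hlim : Filter.Tendsto h Filter.atTop (nhds 0) := tendsto_one_div_add_atTop_nhds_zero_nat
  have hlim' : Filter.Tendsto h Filter.atTop (nhdsWithin 0 {0}ᶜ) :=
    tendsto_nhdsWithin_of_tendsto_nhds_of_eventually_within _ hlim
      (Filter.Eventually.of_forall fun k => (hpos k).ne')
  have hmono : ∀ x, Monotone fun s : ℝ => f (x + s • v) := fun x =>
    monotone_of_deriv_nonneg
      (fun t => (HasLineDerivAt.hasDerivAt_add_smul hf x t).differentiableAt)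
      (fun t => by rw [(HasLineDerivAt.hasDerivAt_add_smul hf x t).deriv]; exact hf'0 _)
  set g : ℕ → E → ℝ := fun k x => w x * ((h k)⁻¹ * (f (x + h k • v) - f x)) with hg
  have hg0 : ∀ k x, 0 ≤ g k x := fun k x => by
    refine mul_nonneg (hw0 x) (mul_nonneg (inv_nonneg.2 (hpos k).le) (sub_nonneg.2 ?_))
    simpa using hmono x (hpos k).le
  have hgm : ∀ k, Measurable (g k) := fun k =>
    hw.continuous.measurable.mul (((hfm.comp (measurable_id.add_const _)).sub hfm).const_mul _)
  have hglim : ∀ x, Filter.Tendsto (fun k => g k x) Filter.atTop (nhds (w x * f' x)) := by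
    intro x
    have h1 := (hasDerivAt_iff_tendsto_slope.1 (hf x)).comp hlim'
    refine (h1.const_mul (w x)).congr fun k => ?_
    simp [hg, slope_def_field, div_eq_inv_mul]
  have hwf : ∀ {u : E → ℝ}, Continuous u → HasCompactSupport u →
      Integrable (fun x => u x * f x) μ := fun hu huc => by
    simpa [smul_eq_mul] using hfi.integrable_smul_left_of_hasCompactSupport hu huc
  have hshift : ∀ a : E, Continuous (fun x => w (x - a)) ∧ HasCompactSupport (fun x => w (x - a)) :=
    fun a => ⟨hw.continuous.comp (continuous_id.sub continuous_const),
      hwc.comp_homeomorph (Homeomorph.subRight a)⟩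
  have hws : ∀ a : E, Integrable (fun x => w (x - a) * f x) μ := fun a =>
    hwf (hshift a).1 (hshift a).2
  have hws' : ∀ a : E, Integrable (fun x => w x * f (x + a)) μ := fun a => by
    simpa using (hws a).comp_add_right a
  have hgi : ∀ k, Integrable (g k) μ := fun k => by
    have := ((hws' (h k • v)).sub (hws' 0)).const_mul (h k)⁻¹
    refine this.congr (Filter.Eventually.of_forall fun x => ?_)
    simp only [hg, Pi.sub_apply, add_zero]
    ring
  have hint : ∀ k, ∫ x, g k x ∂μ = ∫ x, (h k)⁻¹ * (w (x - h k • v) - w x) * f x ∂μ := by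
    intro k
    have e1 : ∫ x, g k x ∂μ
        = (h k)⁻¹ * (∫ x, w x * f (x + h k • v) ∂μ - ∫ x, w x * f x ∂μ) := by
      rw [← integral_sub (hws' _) (by simpa using hws' 0), ← integral_const_mul]
      congr 1; funext x; simp only [hg]; ring
    have e2 : ∫ x, (h k)⁻¹ * (w (x - h k • v) - w x) * f x ∂μ
        = (h k)⁻¹ * (∫ x, w (x - h k • v) * f x ∂μ - ∫ x, w x * f x ∂μ) := by
      rw [← integral_sub (hws _) (by simpa using hws 0), ← integral_const_mul]
      congr 1; funext x; ring
    rw [e1, e2, ← integral_add_right_eq_self (fun x => w (x - h k • v) * f x) (h k • v)]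
    simp
  obtain ⟨L, hL⟩ := hw.lipschitzWith_of_hasCompactSupport hwc one_ne_zero
  set K : Set E := Metric.cthickening ‖v‖ (tsupport w) with hK
  have hKc : IsCompact K := hwc.cthickening
  have hDCT : Filter.Tendsto (fun k => ∫ x, g k x ∂μ) Filter.atTop
      (nhds (-∫ x, fderiv ℝ w x v * f x ∂μ)) := by
    rw [← integral_neg]
    simp_rw [hint]
    refine tendsto_integral_of_dominated_convergence
      (K.indicator fun x => L * ‖v‖ * |f x|) (fun k => ?_) ?_ (fun k => ?_) ?_
    · exact ((((hshift _).1.sub hw.continuous).measurable.const_mul _).mul hfm).aestronglyMeasurable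
    · rw [integrable_indicator_iff hKc.measurableSet]
      exact (hfi.integrableOn_isCompact hKc).norm.const_mul _
    · refine Filter.Eventually.of_forall fun x => ?_
      by_cases hx : x ∈ K
      · rw [Set.indicator_of_mem hx, norm_mul, norm_mul, Real.norm_eq_abs (f x)]
        refine mul_le_mul_of_nonneg_right ?_ (abs_nonneg _)
        have := hL.dist_le_mul (x - h k • v) x
        rw [dist_eq_norm, dist_eq_norm] at this
        have e : ‖x - h k • v - x‖ = h k * ‖v‖ := by
          rw [show x - h k • v - x = -(h k • v) by abel, norm_neg, norm_smul,
            Real.norm_of_nonneg (hpos k).le]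
        rw [e] at this
        rw [norm_inv, Real.norm_of_nonneg (hpos k).le]
        calc (h k)⁻¹ * ‖w (x - h k • v) - w x‖ ≤ (h k)⁻¹ * (L * (h k * ‖v‖)) :=
              mul_le_mul_of_nonneg_left this (inv_nonneg.2 (hpos k).le)
          _ = L * ‖v‖ := by have := (hpos k).ne'; field_simp
      · rw [Set.indicator_of_notMem hx]
        have h1 : w x = 0 := by
          by_contra hne
          exact hx (Metric.self_subset_cthickening _ (subset_tsupport _ hne))
        have h2 : w (x - h k • v) = 0 := by
          by_contra hne
          refine hx (Metric.mem_cthickening_of_dist_le x _ _ _ (subset_tsupport _ hne) ?_)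
          rw [dist_eq_norm, sub_sub_cancel, norm_smul, Real.norm_of_nonneg (hpos k).le]
          exact mul_le_of_le_one_left (norm_nonneg _) (hle k)
        simp [h1, h2]
    · refine Filter.Eventually.of_forall fun x => ?_
      have hd : HasLineDerivAt ℝ w (fderiv ℝ w x (-v)) x (-v) :=
        (hw.differentiable one_ne_zero x).hasFDerivAt.hasLineDerivAt _
      have h1 := (hasDerivAt_iff_tendsto_slope.1 hd).comp hlim'
      rw [map_neg] at h1
      have h2 := h1.mul_const (f x)
      rw [neg_mul] at h2
      refine h2.congr fun k => ?_
      simp [slope_def_field, div_eq_inv_mul, sub_eq_add_neg]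
  have hL0 : 0 ≤ -∫ x, fderiv ℝ w x v * f x ∂μ :=
    ge_of_tendsto hDCT (Filter.Eventually.of_forall fun k => integral_nonneg (hg0 k))
  have hmeas : Measurable fun x => w x * f' x :=
    measurable_of_tendsto_metrizable hgm (tendsto_pi_nhds.2 hglim)
  have hF : ∫⁻ x, ENNReal.ofReal (w x * f' x) ∂μ
      ≤ ENNReal.ofReal (-∫ x, fderiv ℝ w x v * f x ∂μ) := by
    have e1 : ∀ x, Filter.liminf (fun k => ENNReal.ofReal (g k x)) Filter.atTop
        = ENNReal.ofReal (w x * f' x) := fun x =>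
      (ENNReal.tendsto_ofReal (hglim x)).liminf_eq
    have e2 : Filter.liminf (fun k => ∫⁻ x, ENNReal.ofReal (g k x) ∂μ) Filter.atTop
        = ENNReal.ofReal (-∫ x, fderiv ℝ w x v * f x ∂μ) := by
      simp_rw [← fun k => ofReal_integral_eq_lintegral_ofReal (hgi k)
        (Filter.Eventually.of_forall (hg0 k))]
      exact (ENNReal.tendsto_ofReal hDCT).liminf_eq
    rw [← e2]
    simp_rw [← e1]
    exact lintegral_liminf_le fun k => (hgm k).ennreal_ofReal
  have hn0 : ∀ x, 0 ≤ w x * f' x := fun x => mul_nonneg (hw0 x) (hf'0 x)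
  refine ⟨⟨hmeas.aestronglyMeasurable, ?_⟩, ?_⟩
  · rw [hasFiniteIntegral_iff_ofReal (Filter.Eventually.of_forall hn0)]
    exact hF.trans_lt ENNReal.ofReal_lt_top
  · rw [integral_eq_lintegral_of_nonneg_ae (Filter.Eventually.of_forall hn0)
      hmeas.aestronglyMeasurable]
    exact ENNReal.toReal_le_of_le_ofReal hL0 hF

end LineDeriv

/-- Smooth cutoff functions with gradients tending uniformly to zero. -/
theorem exists_cutoff (E : Type*) [NormedAddCommGroup E] [InnerProductSpace ℝ E]
    [FiniteDimensional ℝ E] :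
    ∃ (L : ℝ) (χ : ℕ → E → ℝ), (∀ k, ContDiff ℝ 1 (χ k)) ∧ (∀ k, HasCompactSupport (χ k)) ∧
      (∀ k x, 0 ≤ χ k x) ∧ (∀ k x, χ k x ≤ 1) ∧
      (∀ x, Filter.Tendsto (fun k => χ k x) Filter.atTop (nhds 1)) ∧
      ∀ k x, ‖fderiv ℝ (χ k) x‖ ≤ L * (1 / ((k : ℝ) + 1)) := by
  let b : ContDiffBump (0 : E) := ⟨1, 2, one_pos, one_lt_two⟩
  have hb : ContDiff ℝ 1 b := b.contDiff
  obtain ⟨L, hL⟩ := hb.lipschitzWith_of_hasCompactSupport b.hasCompactSupport one_ne_zero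
  have hk : ∀ k : ℕ, (1 / ((k : ℝ) + 1)) ≠ 0 := fun k => Nat.one_div_pos_of_nat.ne'
  refine ⟨L, fun k x => b ((1 / ((k : ℝ) + 1)) • x), fun k => ?_, fun k => ?_, fun k x => b.nonneg,
    fun k x => b.le_one, fun x => ?_, fun k x => ?_⟩
  · exact hb.comp (contDiff_const_smul _)
  · exact b.hasCompactSupport.comp_homeomorph (Homeomorph.smulOfNeZero _ (hk k))
  · refine tendsto_const_nhds.congr' ?_
    have h1 : Filter.Tendsto (fun k : ℕ => (1 / ((k : ℝ) + 1)) • x) Filter.atTop (nhds 0) := by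
      simpa using (tendsto_one_div_add_atTop_nhds_zero_nat (𝕜 := ℝ)).smul_const x
    filter_upwards [h1.eventually (Metric.closedBall_mem_nhds 0 one_pos)] with k hk
    exact (b.one_of_mem_closedBall hk).symm
  · have h0 : 0 ≤ 1 / ((k : ℝ) + 1) := by positivity
    have : LipschitzWith (L * ⟨1 / ((k : ℝ) + 1), h0⟩)
        (fun x => b ((1 / ((k : ℝ) + 1)) • x)) := by
      refine hL.comp (LipschitzWith.of_dist_le_mul fun y z => ?_)
      rw [dist_smul₀, Real.norm_of_nonneg h0]
      rfl
    exact norm_fderiv_le_of_lipschitz ℝ this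

theorem exists_knothe_map_euclidean {n : ℕ} {ρ σ : EuclideanSpace ℝ (Fin n) → ℝ}
    (hρc : Continuous ρ) (hσc : Continuous σ) (hρp : ∀ x, 0 < ρ x) (hσp : ∀ x, 0 < σ x)
    (hρb : ∃ C, ∀ x, ρ x ≤ C * ∏ i, (1 + x i ^ 2)⁻¹)
    (hσb : ∃ C, ∀ x, σ x ≤ C * ∏ i, (1 + x i ^ 2)⁻¹)
    (hmass : ∫ x, ρ x = ∫ x, σ x) :
    ∃ (T : EuclideanSpace ℝ (Fin n) → EuclideanSpace ℝ (Fin n))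
      (a : EuclideanSpace ℝ (Fin n) → Fin n → ℝ),
      Measurable T ∧ (∀ x i, 0 < a x i) ∧
      (∀ i x, HasLineDerivAt ℝ (fun y => T y i) (a x i) x (EuclideanSpace.single i 1)) ∧
      (∀ x, (∏ i, a x i) * σ (T x) = ρ x) ∧
      ∀ h : EuclideanSpace ℝ (Fin n) → ENNReal, Measurable h →
        ∫⁻ x, h (T x) * ENNReal.ofReal (ρ x) = ∫⁻ y, h y * ENNReal.ofReal (σ y) := by
  have hmp := EuclideanSpace.volume_preserving_symm_measurableEquiv_toLp (Fin n)
  have hmp' := hmp.symm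
  have hcont : Continuous fun x : Fin n → ℝ => WithLp.toLp 2 x := PiLp.continuous_toLp 2 _
  have hint : ∀ f : EuclideanSpace ℝ (Fin n) → ℝ,
      ∫ x : Fin n → ℝ, f (WithLp.toLp 2 x) = ∫ x, f x := fun f =>
    hmp'.integral_comp (MeasurableEquiv.measurableEmbedding _) f
  obtain ⟨T, a, hTm, hap, hTd, hprod, hpush⟩ := exists_knothe_map n (Ω := Unit)
    (fun _ x => ρ (WithLp.toLp 2 x)) (fun _ x => σ (WithLp.toLp 2 x))
    ((hρc.comp hcont).measurable.comp measurable_snd)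
    ((hσc.comp hcont).measurable.comp measurable_snd)
    (fun _ => hρc.comp hcont) (fun _ => hσc.comp hcont) (fun _ _ => hρp _) (fun _ _ => hσp _)
    (fun _ => hρb.imp fun C hC x => hC (WithLp.toLp 2 x))
    (fun _ => hσb.imp fun C hC x => hC (WithLp.toLp 2 x))
    (fun _ => by rw [hint ρ, hint σ, hmass])
  have hT1 : Measurable fun x : Fin n → ℝ => T () x :=
    hTm.comp (measurable_const.prodMk measurable_id)
  refine ⟨fun x => WithLp.toLp 2 (T () (WithLp.ofLp x)), fun x => a () (WithLp.ofLp x), ?_,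
    fun x i => hap _ _ i, fun i x => ?_, fun x => ?_, fun h hh => ?_⟩
  · exact hcont.measurable.comp (hT1.comp (PiLp.continuous_ofLp 2 _).measurable)
  · have h1 := hTd () (WithLp.ofLp x) i
    have h2 : HasDerivAt (fun t => T () (Function.update (WithLp.ofLp x) i t) i)
        (a () (WithLp.ofLp x) i) (WithLp.ofLp x i + 0) := by rwa [add_zero]
    have h3 := h2.comp_const_add (WithLp.ofLp x i) 0
    refine h3.congr_of_eventuallyEq (Filter.Eventually.of_forall fun t => ?_)
    simp only
    congr 2
    funext j
    by_cases hj : j = i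
    · subst hj; simp
    · simp [hj]
  · simpa using hprod () (WithLp.ofLp x)
  · have e := hpush () (fun x => h (WithLp.toLp 2 x)) (hh.comp hcont.measurable)
    have hl : ∀ f : EuclideanSpace ℝ (Fin n) → ENNReal,
        ∫⁻ x : Fin n → ℝ, f (WithLp.toLp 2 x) = ∫⁻ x, f x := fun f =>
      hmp'.lintegral_comp_emb (MeasurableEquiv.measurableEmbedding _) f
    have h1 := hl fun x => h (WithLp.toLp 2 (T () (WithLp.ofLp x))) * ENNReal.ofReal (ρ x)
    have h2 := hl fun x => h x * ENNReal.ofReal (σ x)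
    rw [← h1, ← h2]
    exact e

theorem integral_comp_of_push {α : Type*} [MeasurableSpace α] {μ : Measure α} {T : α → α}
    {ρ σ φ : α → ℝ} (hTm : Measurable T) (hρm : Measurable ρ) (hσm : Measurable σ)
    (hρ : ∀ x, 0 ≤ ρ x)
    (hσ : ∀ x, 0 ≤ σ x) (hφ : ∀ x, 0 ≤ φ x) (hφm : Measurable φ)
    (hpush : ∀ h : α → ENNReal, Measurable h →
        ∫⁻ x, h (T x) * ENNReal.ofReal (ρ x) ∂μ = ∫⁻ y, h y * ENNReal.ofReal (σ y) ∂μ)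
    (hi : Integrable (fun y => φ y * σ y) μ) :
    Integrable (fun x => φ (T x) * ρ x) μ ∧ ∫ x, φ (T x) * ρ x ∂μ = ∫ y, φ y * σ y ∂μ := by
  have e := hpush (fun y => ENNReal.ofReal (φ y)) hφm.ennreal_ofReal
  simp_rw [← ENNReal.ofReal_mul (hφ _)] at e
  have n1 : 0 ≤ᵐ[μ] fun x => φ (T x) * ρ x :=
    Filter.Eventually.of_forall fun x => mul_nonneg (hφ _) (hρ _)
  have n2 : 0 ≤ᵐ[μ] fun x => φ x * σ x :=
    Filter.Eventually.of_forall fun x => mul_nonneg (hφ _) (hσ _)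
  have m1 : AEStronglyMeasurable (fun x => φ (T x) * ρ x) μ :=
    ((hφm.comp hTm).mul hρm).aestronglyMeasurable
  refine ⟨⟨m1, ?_⟩, ?_⟩
  · rw [hasFiniteIntegral_iff_ofReal n1, e, ← hasFiniteIntegral_iff_ofReal n2]
    exact hi.2
  · rw [integral_eq_lintegral_of_nonneg_ae n1 m1, e,
      integral_eq_lintegral_of_nonneg_ae n2 (hφm.mul hσm).aestronglyMeasurable]

theorem card_mul_le_sum_of_pow_le_prod {n : ℕ} (hn : n ≠ 0) {a : Fin n → ℝ} {c : ℝ}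
    (ha : ∀ i, 0 ≤ a i) (hc : 0 ≤ c) (h : c ^ n ≤ ∏ i, a i) : n * c ≤ ∑ i, a i := by
  have hn' : (n : ℝ) ≠ 0 := by exact_mod_cast hn
  have h1 := Real.geom_mean_le_arith_mean_weighted Finset.univ (fun _ : Fin n => (n : ℝ)⁻¹) a
    (fun _ _ => by positivity) (by simp [hn']) (fun i _ => ha i)
  rw [Real.finsetProd_rpow _ _ (fun i _ => ha i), ← Finset.mul_sum] at h1
  have h2 : c ≤ (∏ i, a i) ^ (n : ℝ)⁻¹ := by
    rw [← Real.pow_rpow_inv_natCast hc hn]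
    exact Real.rpow_le_rpow (by positivity) h (by positivity)
  have h3 := h2.trans h1
  rwa [inv_mul_eq_div, le_div_iff₀ (by positivity), mul_comm] at h3

theorem inv_pow_le_prod_inv {n : ℕ} (y : EuclideanSpace ℝ (Fin n)) :
    ((1 + ‖y‖ ^ 2) ^ n)⁻¹ ≤ ∏ i, (1 + y i ^ 2)⁻¹ := by
  rw [Finset.prod_inv_distrib]
  refine inv_anti₀ (Finset.prod_pos fun i _ => by positivity) ?_
  calc ∏ i, (1 + y i ^ 2) ≤ ∏ _i : Fin n, (1 + ‖y‖ ^ 2) := by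
        refine Finset.prod_le_prod (fun i _ => by positivity) fun i _ => ?_
        have h2 : y i ^ 2 ≤ ‖y‖ ^ 2 := by
          rw [← sq_abs, ← Real.norm_eq_abs]
          exact pow_le_pow_left₀ (norm_nonneg _) (PiLp.norm_apply_le y i) 2
        linarith
    _ = (1 + ‖y‖ ^ 2) ^ n := by simp

/-- Sharp Sobolev inequality for a positive function `g ^ ((n - 2) / 2)`. -/
theorem sobolev_of_pos {n : ℕ} (hn : 3 ≤ n) {g : EuclideanSpace ℝ (Fin n) → ℝ}
    (hg : ContDiff ℝ 1 g) (hgp : ∀ x, 0 < g x)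
    (hgb : ∃ C, ∀ x, g x ^ n ≤ C * ∏ i, (1 + x i ^ 2)⁻¹)
    (hgi : Integrable fun x => g x ^ (n - 2))
    (hD : Integrable fun x => g x ^ n * (‖fderiv ℝ g x‖ / g x ^ 2) ^ 2)
    {k Z Y : ℝ} (hk : 0 < k)
    (hZi : Integrable fun y : EuclideanSpace ℝ (Fin n) => ((1 + ‖y‖ ^ 2) ^ n)⁻¹)
    (hYi : Integrable fun y : EuclideanSpace ℝ (Fin n) => ‖y‖ ^ 2 * ((1 + ‖y‖ ^ 2) ^ n)⁻¹)
    (hZ : ∫ y : EuclideanSpace ℝ (Fin n), ((1 + ‖y‖ ^ 2) ^ n)⁻¹ = Z)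
    (hY : ∫ y : EuclideanSpace ℝ (Fin n), ‖y‖ ^ 2 * ((1 + ‖y‖ ^ 2) ^ n)⁻¹ = Y)
    (hYZ : ((n : ℝ) - 2) * Y = n * Z) (hmass : ∫ x, g x ^ n = k ^ n * Z) :
    4 * n * k ^ (n - 2) * Z ≤ ((n : ℝ) - 2) * ∫ x, g x ^ n * (‖fderiv ℝ g x‖ / g x ^ 2) ^ 2 := by
  have hW : ∀ y : EuclideanSpace ℝ (Fin n), 0 < 1 + ‖y‖ ^ 2 := fun y => by positivity
  have hWc : Continuous fun y : EuclideanSpace ℝ (Fin n) => ((1 + ‖y‖ ^ 2) ^ n)⁻¹ :=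
    Continuous.inv₀ (by fun_prop) fun y => (pow_pos (hW y) n).ne'
  have hρc : Continuous fun x => g x ^ n := hg.continuous.pow n
  have hσp : ∀ y : EuclideanSpace ℝ (Fin n), 0 < k ^ n * ((1 + ‖y‖ ^ 2) ^ n)⁻¹ := fun y => by
    have := hW y
    positivity
  obtain ⟨T, a, hTm, hap, hTd, hprod, hpush⟩ := exists_knothe_map_euclidean
    (ρ := fun x => g x ^ n) (σ := fun y => k ^ n * ((1 + ‖y‖ ^ 2) ^ n)⁻¹)
    hρc (hWc.const_mul _) (fun x => pow_pos (hgp x) n) hσp hgb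
    ⟨k ^ n, fun y => mul_le_mul_of_nonneg_left (inv_pow_le_prod_inv y) (by positivity)⟩
    (by rw [integral_const_mul, hZ, hmass])
  have hpush' : ∀ φ : EuclideanSpace ℝ (Fin n) → ℝ, (∀ y, 0 ≤ φ y) → Measurable φ →
      Integrable (fun y => φ y * ((1 + ‖y‖ ^ 2) ^ n)⁻¹) →
      Integrable (fun x => φ (T x) * g x ^ n) ∧
      ∫ x, φ (T x) * g x ^ n = k ^ n * ∫ y, φ y * ((1 + ‖y‖ ^ 2) ^ n)⁻¹ := by
    intro φ h0 hm hi
    have := integral_comp_of_push hTm hρc.measurable (hWc.const_mul _).measurable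
      (fun x => (pow_pos (hgp x) n).le) (fun y => (hσp y).le) h0 hm hpush
      ((hi.const_mul (k ^ n)).congr (Filter.Eventually.of_forall fun y => by ring))
    refine ⟨this.1, this.2.trans ?_⟩
    rw [← integral_const_mul]
    congr 1; funext y; ring
  obtain ⟨hB2i, hB2⟩ := hpush' (fun y => ‖y‖ ^ 2) (fun y => by positivity) (by fun_prop) hYi
  have hsum : (fun y : EuclideanSpace ℝ (Fin n) => (1 + ‖y‖ ^ 2) * ((1 + ‖y‖ ^ 2) ^ n)⁻¹)
      = fun y => ((1 + ‖y‖ ^ 2) ^ n)⁻¹ + ‖y‖ ^ 2 * ((1 + ‖y‖ ^ 2) ^ n)⁻¹ := by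
    funext y; ring
  obtain ⟨hBi, hB⟩ := hpush' (fun y => 1 + ‖y‖ ^ 2) (fun y => (hW y).le) (by fun_prop)
    (by rw [hsum]; exact hZi.add hYi)
  rw [hsum, integral_add hZi hYi, hZ, hY] at hB
  rw [hY] at hB2
  have hTloc : ∀ i, LocallyIntegrable (fun x => T x i) := by
    intro i
    have hTim : Measurable fun x => T x i :=
      (EuclideanSpace.proj (𝕜 := ℝ) i).continuous.measurable.comp hTm
    rw [locallyIntegrable_iff]
    intro K hK
    have h1 : IntegrableOn (fun x => (g x ^ n)⁻¹ * ((1 + ‖T x‖ ^ 2) * g x ^ n)) K :=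
      IntegrableOn.continuousOn_mul
        (hρc.inv₀ fun x => (pow_pos (hgp x) n).ne').continuousOn hBi.integrableOn hK
    refine h1.mono' hTim.aestronglyMeasurable (Filter.Eventually.of_forall fun x => ?_)
    have h2 : (g x ^ n)⁻¹ * ((1 + ‖T x‖ ^ 2) * g x ^ n) = 1 + ‖T x‖ ^ 2 := by
      have := (pow_pos (hgp x) n).ne'
      field_simp
    rw [h2]
    have h3 := PiLp.norm_apply_le (T x) i
    nlinarith [sq_nonneg (‖T x‖ - 1), norm_nonneg (T x)]
  obtain ⟨L, χ, hχ, hχc, hχ0, hχ1, hχlim, hχL⟩ := exists_cutoff (EuclideanSpace ℝ (Fin n))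
  have hn2 : (0 : ℝ) < (n : ℝ) - 2 := by
    have : (3 : ℝ) ≤ n := by exact_mod_cast hn
    linarith
  set D := ∫ x, g x ^ n * (‖fderiv ℝ g x‖ / g x ^ 2) ^ 2 with hDdef
  set P := ∫ x, g x ^ (n - 2) with hP
  have key : ∀ j : ℕ, (n / k) * ∫ x, χ j x * ((1 + ‖T x‖ ^ 2) * g x ^ n)
      ≤ ((n : ℝ) - 1) / 2 * (k / 2 * D + 2 / k * (k ^ n * Y)) +
        (L * (1 / ((j : ℝ) + 1))) * (1 / 2 * (P + k ^ n * Y)) := by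
    intro j
    set w := fun x => χ j x * g x ^ (n - 1) with hw
    have hwC : ContDiff ℝ 1 w := (hχ j).mul (hg.pow _)
    have hwc : HasCompactSupport w := (hχc j).mul_right
    have hw0 : ∀ x, 0 ≤ w x := fun x => mul_nonneg (hχ0 j x) (pow_pos (hgp x) _).le
    have hi : ∀ i, Integrable (fun x => w x * a x i) ∧
        ∫ x, w x * a x i ≤ -∫ x, fderiv ℝ w x (EuclideanSpace.single i 1) * T x i := fun i =>
      integral_mul_lineDeriv_le hwC hwc hw0
        ((EuclideanSpace.proj (𝕜 := ℝ) i).continuous.measurable.comp hTm) (hTloc i)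
        (fun x => (hap x i).le) (hTd i)
    have hdi : ∀ i, Integrable fun x => fderiv ℝ w x (EuclideanSpace.single i 1) * T x i := by
      intro i
      have h1 : Continuous fun x => fderiv ℝ w x (EuclideanSpace.single i 1) :=
        (hwC.continuous_fderiv one_ne_zero).clm_apply continuous_const
      have h2 : HasCompactSupport fun x => fderiv ℝ w x (EuclideanSpace.single i 1) :=
        hwc.fderiv_apply ℝ _
      simpa [smul_eq_mul] using (hTloc i).integrable_smul_left_of_hasCompactSupport h1 h2
    have hAM : ∀ x, (n / k) * (χ j x * ((1 + ‖T x‖ ^ 2) * g x ^ n)) ≤ ∑ i, w x * a x i := by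
      intro x
      have hpr : (g x * (1 + ‖T x‖ ^ 2) / k) ^ n ≤ ∏ i, a x i := by
        have h1 := hprod x
        rw [div_pow, mul_pow, ← h1]
        have := pow_pos (hW (T x)) n
        have hkn := pow_pos hk n
        refine le_of_eq ?_
        field_simp
      have h2 := card_mul_le_sum_of_pow_le_prod (by omega) (fun i => (hap x i).le)
        (div_nonneg (mul_nonneg (hgp x).le (hW (T x)).le) hk.le) hpr
      rw [← Finset.mul_sum]
      refine le_trans (le_of_eq ?_) (mul_le_mul_of_nonneg_left h2 (hw0 x))
      have : g x ^ n = g x ^ (n - 1) * g x := by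
        rw [← pow_succ]; congr 1; omega
      rw [hw, this]
      ring
    have hfd : ∀ x, -∑ i, fderiv ℝ w x (EuclideanSpace.single i 1) * T x i
        ≤ ((n : ℝ) - 1) / 2 * (k / 2 * (g x ^ n * (‖fderiv ℝ g x‖ / g x ^ 2) ^ 2)
            + 2 / k * (‖T x‖ ^ 2 * g x ^ n)) +
          (L * (1 / ((j : ℝ) + 1))) * (1 / 2 * (g x ^ (n - 2) + ‖T x‖ ^ 2 * g x ^ n)) := by
      intro x
      have e1 : ∑ i, fderiv ℝ w x (EuclideanSpace.single i 1) * T x i = fderiv ℝ w x (T x) := by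
        conv_rhs => rw [← (EuclideanSpace.basisFun (Fin n) ℝ).sum_repr (T x)]
        rw [map_sum]
        refine Finset.sum_congr rfl fun i _ => ?_
        simp [mul_comm]
      have e2 : fderiv ℝ w x (T x) = χ j x * ((n - 1 : ℕ) * g x ^ (n - 2) * fderiv ℝ g x (T x))
          + g x ^ (n - 1) * fderiv ℝ (χ j) x (T x) := by
        have hd := ((hχ j).differentiable one_ne_zero x).hasFDerivAt.mul
          (((hg.differentiable one_ne_zero x).hasFDerivAt).pow (n - 1))
        rw [show w = χ j * fun x => g x ^ (n - 1) from rfl, hd.fderiv]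
        simp only [add_apply, smul_apply, smul_eq_mul,
          nsmul_eq_mul]
        rw [show n - 1 - 1 = n - 2 by omega]
      rw [e1, e2]
      have hG := hgp x
      have b1 : -fderiv ℝ g x (T x) ≤ ‖fderiv ℝ g x‖ * ‖T x‖ :=
        (neg_le_abs _).trans ((fderiv ℝ g x).le_opNorm _)
      have b2 : -fderiv ℝ (χ j) x (T x) ≤ L * (1 / ((j : ℝ) + 1)) * ‖T x‖ :=
        (neg_le_abs _).trans (((fderiv ℝ (χ j) x).le_opNorm _).trans
          (mul_le_mul_of_nonneg_right (hχL j x) (norm_nonneg _)))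
      have hL0 : 0 ≤ L * (1 / ((j : ℝ) + 1)) := (norm_nonneg _).trans (hχL j x)
      have hn1 : ((n - 1 : ℕ) : ℝ) = (n : ℝ) - 1 := by
        rw [Nat.cast_sub (by omega)]; simp
      rw [hn1]
      have hn1p : 0 ≤ (n : ℝ) - 1 := by linarith
      have p1 : g x ^ n = g x ^ (n - 2) * g x ^ 2 := by rw [← pow_add]; congr 1; omega
      have p2 : g x ^ (n - 1) = g x ^ (n - 2) * g x := by rw [← pow_succ]; congr 1; omega
      have hGn : 0 < g x ^ (n - 2) := pow_pos hG _
      set d := ‖fderiv ℝ g x‖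
      set t := ‖T x‖
      set Q := g x ^ (n - 2)
      have ht : 0 ≤ t := norm_nonneg _
      have hd : 0 ≤ d := norm_nonneg _
      have c1 : -(χ j x * (((n : ℝ) - 1) * Q * fderiv ℝ g x (T x)))
          ≤ ((n : ℝ) - 1) * Q * (d * t) := by
        calc -(χ j x * (((n : ℝ) - 1) * Q * fderiv ℝ g x (T x)))
            = χ j x * (((n : ℝ) - 1) * Q * -fderiv ℝ g x (T x)) := by ring
          _ ≤ χ j x * (((n : ℝ) - 1) * Q * (d * t)) := by
              refine mul_le_mul_of_nonneg_left (mul_le_mul_of_nonneg_left b1 ?_) (hχ0 j x)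
              positivity
          _ ≤ _ := mul_le_of_le_one_left (by positivity) (hχ1 j x)
      have c2 : -(Q * g x * fderiv ℝ (χ j) x (T x)) ≤ Q * g x * (L * (1 / ((j : ℝ) + 1)) * t) := by
        rw [← mul_neg]
        exact mul_le_mul_of_nonneg_left b2 (by positivity)
      have c3 : Q * (d * t) ≤ 1 / 2 * (k / 2 * (Q * g x ^ 2 * (d / g x ^ 2) ^ 2)
          + 2 / k * (t ^ 2 * (Q * g x ^ 2))) := by
        have : 1 / 2 * (k / 2 * (Q * g x ^ 2 * (d / g x ^ 2) ^ 2)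
          + 2 / k * (t ^ 2 * (Q * g x ^ 2))) - Q * (d * t)
          = Q * (k / 4) * (d / g x - 2 / k * (t * g x)) ^ 2 := by
          field_simp
          ring
        have h' : 0 ≤ Q * (k / 4) * (d / g x - 2 / k * (t * g x)) ^ 2 := by positivity
        linarith
      have c4 : Q * g x * (L * (1 / ((j : ℝ) + 1)) * t)
          ≤ (L * (1 / ((j : ℝ) + 1))) * (1 / 2 * (Q + t ^ 2 * (Q * g x ^ 2))) := by
        have : 0 ≤ (L * (1 / ((j : ℝ) + 1))) * (Q / 2 * (1 - t * g x) ^ 2) := by positivity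
        linarith [this]
      have c5 := mul_le_mul_of_nonneg_left c3 hn1p
      rw [p1, p2]
      linarith
    have hχB : Integrable fun x => χ j x * ((1 + ‖T x‖ ^ 2) * g x ^ n) := by
      refine hBi.bdd_mul (hχ j).continuous.aestronglyMeasurable (c := 1) ?_
      exact Filter.Eventually.of_forall fun x => by
        rw [Real.norm_of_nonneg (hχ0 j x)]; exact hχ1 j x
    calc (n / k) * ∫ x, χ j x * ((1 + ‖T x‖ ^ 2) * g x ^ n)
        = ∫ x, (n / k) * (χ j x * ((1 + ‖T x‖ ^ 2) * g x ^ n)) := (integral_const_mul _ _).symm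
      _ ≤ ∫ x, ∑ i, w x * a x i :=
          integral_mono (hχB.const_mul _) (integrable_finsetSum _ fun i _ => (hi i).1) hAM
      _ = ∑ i, ∫ x, w x * a x i := integral_finsetSum _ fun i _ => (hi i).1
      _ ≤ ∑ i, -∫ x, fderiv ℝ w x (EuclideanSpace.single i 1) * T x i :=
          Finset.sum_le_sum fun i _ => (hi i).2
      _ = ∫ x, -∑ i, fderiv ℝ w x (EuclideanSpace.single i 1) * T x i := by
          rw [integral_neg, integral_finsetSum _ fun i _ => hdi i, Finset.sum_neg_distrib]
      _ ≤ _ := by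
          have i1 : Integrable fun x => ((n : ℝ) - 1) / 2 *
              (k / 2 * (g x ^ n * (‖fderiv ℝ g x‖ / g x ^ 2) ^ 2)
                + 2 / k * (‖T x‖ ^ 2 * g x ^ n)) :=
            ((hD.const_mul (k / 2)).add (hB2i.const_mul (2 / k))).const_mul _
          have i2 : Integrable fun x => (L * (1 / ((j : ℝ) + 1))) *
              (1 / 2 * (g x ^ (n - 2) + ‖T x‖ ^ 2 * g x ^ n)) :=
            ((hgi.add hB2i).const_mul (1 / 2)).const_mul _
          refine (integral_mono (integrable_finsetSum _ fun i _ => hdi i).neg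
            (i1.add i2) hfd).trans (le_of_eq ?_)
          rw [integral_add' i1 i2, integral_const_mul,
            integral_const_mul, integral_const_mul,
            integral_add (hD.const_mul (k / 2)) (hB2i.const_mul (2 / k)),
            integral_add hgi hB2i, integral_const_mul, integral_const_mul, hB2]
  have hl1 : Filter.Tendsto (fun j : ℕ => (n / k) * ∫ x, χ j x * ((1 + ‖T x‖ ^ 2) * g x ^ n))
      Filter.atTop (nhds ((n / k) * ∫ x, 1 * ((1 + ‖T x‖ ^ 2) * g x ^ n))) := by
    refine Filter.Tendsto.const_mul _ ?_
    refine tendsto_integral_of_dominated_convergence _ (fun j =>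
      (hχ j).continuous.aestronglyMeasurable.mul hBi.aestronglyMeasurable) hBi (fun j => ?_)
      (Filter.Eventually.of_forall fun x => (hχlim x).mul_const _)
    refine Filter.Eventually.of_forall fun x => ?_
    have h0 : 0 ≤ (1 + ‖T x‖ ^ 2) * g x ^ n := mul_nonneg (hW _).le (pow_pos (hgp x) n).le
    rw [norm_mul, Real.norm_of_nonneg (hχ0 j x), Real.norm_of_nonneg h0]
    exact mul_le_of_le_one_left h0 (hχ1 j x)
  have hl2 : Filter.Tendsto (fun j : ℕ =>
      ((n : ℝ) - 1) / 2 * (k / 2 * D + 2 / k * (k ^ n * Y)) +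
        (L * (1 / ((j : ℝ) + 1))) * (1 / 2 * (P + k ^ n * Y))) Filter.atTop
      (nhds (((n : ℝ) - 1) / 2 * (k / 2 * D + 2 / k * (k ^ n * Y)) +
        (L * 0) * (1 / 2 * (P + k ^ n * Y)))) :=
    (((tendsto_one_div_add_atTop_nhds_zero_nat (𝕜 := ℝ)).const_mul L).mul_const _).const_add _
  have hfin := le_of_tendsto_of_tendsto' hl1 hl2 key
  simp only [one_mul, mul_zero, zero_mul, add_zero] at hfin
  rw [hB] at hfin
  have hkn : k ^ n = k ^ (n - 2) * k ^ 2 := by rw [← pow_add]; congr 1; omega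
  have hYe : Y = n * Z / ((n : ℝ) - 2) := by rw [← hYZ]; field_simp
  have hn1 : 0 < (n : ℝ) - 1 := by linarith
  rw [hkn, hYe] at hfin
  set R := k ^ (n - 2)
  have e1 : (n : ℝ) / k * (R * k ^ 2 * (Z + n * Z / ((n : ℝ) - 2)))
      = ((n : ℝ) - 1) / 2 * k * (4 * n * R * Z / ((n : ℝ) - 2)) := by
    field_simp; ring
  have e2 : ((n : ℝ) - 1) / 2 * (k / 2 * D + 2 / k * (R * k ^ 2 * (n * Z / ((n : ℝ) - 2))))
      = ((n : ℝ) - 1) / 2 * k * (D / 2 + 2 * n * R * Z / ((n : ℝ) - 2)) := by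
    field_simp
  rw [e1, e2] at hfin
  have h5 := le_of_mul_le_mul_left hfin (by positivity)
  have h6 : 2 * n * R * Z / ((n : ℝ) - 2) ≤ D / 2 := by
    have : 4 * n * R * Z / ((n : ℝ) - 2)
      = 2 * n * R * Z / ((n : ℝ) - 2) + 2 * n * R * Z / ((n : ℝ) - 2) := by ring
    linarith
  rw [div_le_iff₀ hn2] at h6
  linarith

theorem lintegral_ofReal_of_integral_eq {α : Type*} [MeasurableSpace α] {μ : Measure α}
    {f : α → ℝ} {c : ℝ} (hf : 0 ≤ᵐ[μ] f) (h : ∫ x, f x ∂μ = c) (hc : c ≠ 0) :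
    ∫⁻ x, ENNReal.ofReal (f x) ∂μ = ENNReal.ofReal c := by
  rw [← h, ofReal_integral_eq_lintegral_ofReal (.of_integral_ne_zero (h ▸ hc)) hf]

theorem integral_one_add_norm_sq_rpow {n : ℕ} {a : ℝ} (ha : (n : ℝ) / 2 < a) :
    (Integrable fun y : EuclideanSpace ℝ (Fin n) => (1 + ‖y‖ ^ 2) ^ (-a)) ∧
    ∫ y : EuclideanSpace ℝ (Fin n), (1 + ‖y‖ ^ 2) ^ (-a) =
      Real.pi ^ ((n : ℝ) / 2) * Real.Gamma (a - n / 2) / Real.Gamma a := by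
  have ha0 : 0 < a := lt_of_le_of_lt (by positivity) ha
  have hΓ := Real.Gamma_pos_of_pos ha0
  have hΓ' := Real.Gamma_pos_of_pos (sub_pos.2 ha)
  have h1 : ∀ y : EuclideanSpace ℝ (Fin n),
      ∫⁻ t in Set.Ioi (0 : ℝ), ENNReal.ofReal (t ^ (a - 1) * Real.exp (-((1 + ‖y‖ ^ 2) * t)))
        = ENNReal.ofReal ((1 + ‖y‖ ^ 2) ^ (-a) * Real.Gamma a) := by
    intro y
    have hr : 0 < 1 + ‖y‖ ^ 2 := by positivity
    refine lintegral_ofReal_of_integral_eq ?_ ?_ (by positivity)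
    · filter_upwards [ae_restrict_mem measurableSet_Ioi] with t ht
      have : (0 : ℝ) < t := ht
      simp only [Pi.zero_apply]
      positivity
    · rw [Real.integral_rpow_mul_exp_neg_mul_Ioi ha0 hr, one_div, Real.inv_rpow hr.le,
        Real.rpow_neg hr.le]
  have h2 : ∀ t ∈ Set.Ioi (0 : ℝ), ∫⁻ y : EuclideanSpace ℝ (Fin n),
      ENNReal.ofReal (t ^ (a - 1) * Real.exp (-((1 + ‖y‖ ^ 2) * t)))
        = ENNReal.ofReal
          (Real.pi ^ ((n : ℝ) / 2) * (t ^ (a - n / 2 - 1) * Real.exp (-(1 * t)))) := by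
    intro t ht
    have ht : 0 < t := ht
    have hpi := Real.pi_pos
    refine lintegral_ofReal_of_integral_eq (Filter.Eventually.of_forall fun y => ?_) ?_
      (by positivity)
    · simp only [Pi.zero_apply]
      positivity
    · have e : ∀ y : EuclideanSpace ℝ (Fin n), t ^ (a - 1) * Real.exp (-((1 + ‖y‖ ^ 2) * t))
          = t ^ (a - 1) * Real.exp (-(1 * t)) * Real.exp (-t * ‖y‖ ^ 2) := fun y => by
        rw [mul_assoc, ← Real.exp_add]
        ring_nf
      simp_rw [e]
      rw [integral_const_mul, GaussianFourier.integral_rexp_neg_mul_sq_norm ht,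
        finrank_euclideanSpace_fin, Real.div_rpow hpi.le ht.le,
        show a - n / 2 - 1 = (a - 1) - n / 2 by ring, Real.rpow_sub ht (a - 1)]
      ring
  have h3 : ∫⁻ y : EuclideanSpace ℝ (Fin n), ENNReal.ofReal ((1 + ‖y‖ ^ 2) ^ (-a) * Real.Gamma a)
      = ENNReal.ofReal (Real.pi ^ ((n : ℝ) / 2) * Real.Gamma (a - n / 2)) := by
    simp_rw [← h1]
    rw [lintegral_lintegral_swap (by fun_prop), setLIntegral_congr_fun measurableSet_Ioi h2]
    refine lintegral_ofReal_of_integral_eq ?_ ?_ (by have := Real.pi_pos; positivity)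
    · filter_upwards [ae_restrict_mem measurableSet_Ioi] with t ht
      have : (0 : ℝ) < t := ht
      have := Real.pi_pos
      simp only [Pi.zero_apply]
      positivity
    · rw [integral_const_mul, Real.integral_rpow_mul_exp_neg_mul_Ioi (sub_pos.2 ha) one_pos]
      simp
  have h4 : 0 ≤ᵐ[volume] fun y : EuclideanSpace ℝ (Fin n) =>
      (1 + ‖y‖ ^ 2) ^ (-a) * Real.Gamma a := Filter.Eventually.of_forall fun y => by
    simp only [Pi.zero_apply]
    positivity
  have h5 : AEStronglyMeasurable (fun y : EuclideanSpace ℝ (Fin n) =>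
      (1 + ‖y‖ ^ 2) ^ (-a) * Real.Gamma a) volume :=
    Measurable.aestronglyMeasurable (by fun_prop)
  have h6 := integral_eq_lintegral_of_nonneg_ae h4 h5
  rw [h3, integral_mul_const, ENNReal.toReal_ofReal (by positivity), ← eq_div_iff hΓ.ne'] at h6
  have h7 : Integrable fun y : EuclideanSpace ℝ (Fin n) =>
      (1 + ‖y‖ ^ 2) ^ (-a) * Real.Gamma a :=
    ⟨h5, by rw [hasFiniteIntegral_iff_ofReal h4, h3]; exact ENNReal.ofReal_lt_top⟩
  exact ⟨(integrable_mul_const_iff (IsUnit.mk0 _ hΓ.ne') _).1 h7, h6⟩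

theorem sphereVol_eq (n : ℕ) :
    sphereVol n = 2 * Real.pi ^ (((n : ℝ) + 1) / 2) / Real.Gamma (((n : ℝ) + 1) / 2) := by
  have hp : (0 : ℝ) < ((n : ℝ) + 1) / 2 := by positivity
  have hΓ := Real.Gamma_pos_of_pos hp
  have hpi := Real.pi_pos
  rw [sphereVol, EuclideanSpace.volume_ball, Fintype.card_fin]
  push_cast
  rw [Real.Gamma_add_one hp.ne', ENNReal.ofReal_one, one_pow, one_mul,
    ENNReal.toReal_ofReal (by positivity), Real.sqrt_eq_rpow, ← Real.rpow_natCast,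
    ← Real.rpow_mul hpi.le]
  push_cast
  rw [show 1 / 2 * ((n : ℝ) + 1) = ((n : ℝ) + 1) / 2 by ring]
  field_simp

theorem integral_inv_one_add_norm_sq_pow {n : ℕ} (hn : 3 ≤ n) :
    (Integrable fun y : EuclideanSpace ℝ (Fin n) => ((1 + ‖y‖ ^ 2) ^ n)⁻¹) ∧
    (Integrable fun y : EuclideanSpace ℝ (Fin n) => ‖y‖ ^ 2 * ((1 + ‖y‖ ^ 2) ^ n)⁻¹) ∧
    2 ^ n * ∫ y : EuclideanSpace ℝ (Fin n), ((1 + ‖y‖ ^ 2) ^ n)⁻¹ = sphereVol n ∧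
    ((n : ℝ) - 2) * ∫ y : EuclideanSpace ℝ (Fin n), ‖y‖ ^ 2 * ((1 + ‖y‖ ^ 2) ^ n)⁻¹ =
      n * ∫ y : EuclideanSpace ℝ (Fin n), ((1 + ‖y‖ ^ 2) ^ n)⁻¹ := by
  have hn' : (3 : ℝ) ≤ n := by exact_mod_cast hn
  have hpi := Real.pi_pos
  have hW : ∀ y : EuclideanSpace ℝ (Fin n), 0 < 1 + ‖y‖ ^ 2 := fun y => by positivity
  obtain ⟨i1, e1⟩ := integral_one_add_norm_sq_rpow (n := n) (a := n) (by linarith)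
  obtain ⟨i2, e2⟩ := integral_one_add_norm_sq_rpow (n := n) (a := n - 1) (by linarith)
  have f1 : ∀ y : EuclideanSpace ℝ (Fin n), (1 + ‖y‖ ^ 2) ^ (-(n : ℝ)) = ((1 + ‖y‖ ^ 2) ^ n)⁻¹ :=
    fun y => by rw [Real.rpow_neg (hW y).le, Real.rpow_natCast]
  have f2 : ∀ y : EuclideanSpace ℝ (Fin n), ‖y‖ ^ 2 * ((1 + ‖y‖ ^ 2) ^ n)⁻¹ =
      (1 + ‖y‖ ^ 2) ^ (-((n : ℝ) - 1)) - ((1 + ‖y‖ ^ 2) ^ n)⁻¹ := fun y => by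
    rw [show -((n : ℝ) - 1) = -(n : ℝ) + 1 by ring, Real.rpow_add (hW y), f1, Real.rpow_one]
    ring
  simp_rw [f1] at i1 e1
  simp_rw [f2]
  refine ⟨i1, i2.sub i1, ?_, ?_⟩
  · rw [e1, sphereVol_eq]
    have d := Real.Gamma_mul_Gamma_add_half ((n : ℝ) / 2)
    rw [show 2 * ((n : ℝ) / 2) = n by ring, show (n : ℝ) / 2 + 1 / 2 = ((n : ℝ) + 1) / 2 by ring,
      Real.rpow_sub two_pos, Real.rpow_one, Real.rpow_natCast, Real.sqrt_eq_rpow] at d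
    have g1 := Real.Gamma_pos_of_pos (show 0 < (n : ℝ) by linarith)
    have g2 := Real.Gamma_pos_of_pos (show 0 < ((n : ℝ) + 1) / 2 by linarith)
    rw [show ((n : ℝ) + 1) / 2 = n / 2 + 1 / 2 by ring, Real.rpow_add hpi,
      show (n : ℝ) / 2 + 1 / 2 = ((n : ℝ) + 1) / 2 by ring, show (n : ℝ) - n / 2 = n / 2 by ring]
    rw [mul_div_assoc', div_eq_div_iff g1.ne' g2.ne']
    have p2 : (0 : ℝ) < 2 ^ n := by positivity
    calc _ = 2 ^ n * Real.pi ^ ((n : ℝ) / 2) *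
          (Real.Gamma (n / 2) * Real.Gamma (((n : ℝ) + 1) / 2)) := by ring
      _ = _ := by rw [d]; field_simp
  · rw [integral_sub i2 i1, e1, e2]
    have g1 := Real.Gamma_pos_of_pos (show 0 < (n : ℝ) - 1 by linarith)
    have h1 := Real.Gamma_add_one (show (n : ℝ) - 1 ≠ 0 by linarith)
    have h2 := Real.Gamma_add_one (show (n : ℝ) / 2 - 1 ≠ 0 by linarith)
    rw [sub_add_cancel] at h1 h2
    rw [show (n : ℝ) - n / 2 = n / 2 by ring, show (n : ℝ) - 1 - n / 2 = n / 2 - 1 by ring, h1, h2]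
    have : (n : ℝ) - 1 ≠ 0 := by linarith
    field_simp
    ring

theorem hasFDerivAt_inv_one_add_norm_sq_pow {n : ℕ} (x : EuclideanSpace ℝ (Fin n)) :
    HasFDerivAt (fun y : EuclideanSpace ℝ (Fin n) => ((1 + ‖y‖ ^ 2) ^ n)⁻¹)
      ((-(2 * n * ((1 + ‖x‖ ^ 2) ^ n)⁻¹ / (1 + ‖x‖ ^ 2))) • innerSL ℝ x) x := by
  have hW : 0 < 1 + ‖x‖ ^ 2 := by positivity
  have h1 : HasFDerivAt (fun y : EuclideanSpace ℝ (Fin n) => 1 + ‖y‖ ^ 2) (2 • innerSL ℝ x) x :=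
    ((hasStrictFDerivAt_norm_sq x).hasFDerivAt).const_add 1
  have h2 : HasDerivAt (fun t : ℝ => (t ^ n)⁻¹) _ (1 + ‖x‖ ^ 2) :=
    (hasDerivAt_pow n (1 + ‖x‖ ^ 2)).inv (pow_pos hW n).ne'
  refine (h2.comp_hasFDerivAt x h1).congr_fderiv ?_
  ext v
  rcases n with _ | n
  · simp
  · simp only [smul_apply, smul_eq_mul, Nat.add_sub_cancel, nsmul_eq_mul]
    field_simp
    push_cast
    ring

theorem sobolev_of_regularization {n : ℕ} (hn : 3 ≤ n) {f : EuclideanSpace ℝ (Fin n) → ℝ}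
    (hf : ContDiff ℝ 1 f) (hfc : HasCompactSupport f) {Z : ℝ} (hZ0 : 0 < Z)
    (hZ : ∫ y : EuclideanSpace ℝ (Fin n), ((1 + ‖y‖ ^ 2) ^ n)⁻¹ = Z) {ε : ℝ} (hε : 0 < ε) :
    (n : ℝ) * (n - 2) * (((∫ x, |f x| ^ (2 * n / ((n : ℝ) - 2))) / Z) ^ (((n : ℝ) - 2) / n) * Z)
      ≤ (∫ x, ‖fderiv ℝ f x‖ ^ 2) + ε * (n ^ 2 * Z) := by
  have hn' : (3 : ℝ) ≤ n := by exact_mod_cast hn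
  have hn2 : 0 < (n : ℝ) - 2 := by linarith
  have hcast : ((n - 2 : ℕ) : ℝ) = (n : ℝ) - 2 := by rw [Nat.cast_sub (by omega)]; simp
  obtain ⟨hZi, hYi, -, hYZ⟩ := integral_inv_one_add_norm_sq_pow hn
  set w : EuclideanSpace ℝ (Fin n) → ℝ := fun y => ((1 + ‖y‖ ^ 2) ^ n)⁻¹ with hw
  have hW : ∀ y : EuclideanSpace ℝ (Fin n), 0 < 1 + ‖y‖ ^ 2 := fun y => by positivity
  have hw0 : ∀ y, 0 < w y := fun y => by have := hW y; rw [hw]; positivity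
  have hw1 : ∀ y, w y ≤ 1 := fun y =>
    inv_le_one_of_one_le₀ (one_le_pow₀ (by nlinarith [sq_nonneg ‖y‖]))
  have hwC : ContDiff ℝ 1 w :=
    ((contDiff_const.add (contDiff_norm_sq ℝ)).pow n).inv fun y => (pow_pos (hW y) n).ne'
  set N : EuclideanSpace ℝ (Fin n) → ℝ := fun x => f x ^ 2 + ε * w x with hN
  have hN0 : ∀ x, 0 < N x := fun x => by have := hw0 x; rw [hN]; positivity
  have hNC : ContDiff ℝ 1 N := (hf.pow 2).add (contDiff_const.mul hwC)
  obtain ⟨M, hM0, hM⟩ : ∃ M, 0 < M ∧ ∀ x, N x ≤ M * w x := by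
    have hc : HasCompactSupport fun x => f x ^ 2 * (1 + ‖x‖ ^ 2) ^ n := by
      refine (hfc.comp_left (g := fun t : ℝ => t ^ 2) (by simp)).mul_right
    obtain ⟨M, hM⟩ := hc.exists_bound_of_continuous
      (by have := hf.continuous; fun_prop)
    have hM0 : 0 ≤ M := (norm_nonneg _).trans (hM 0)
    refine ⟨M + ε, by positivity, fun x => ?_⟩
    have h1 := (le_abs_self _).trans (hM x)
    have h2 : f x ^ 2 ≤ M * w x := by
      rw [hw]
      simp only
      rwa [← div_eq_mul_inv, le_div_iff₀ (pow_pos (hW x) n)]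
    rw [hN]
    simp only
    linarith
  have hNi : Integrable N := by
    refine (hZi.const_mul M).mono' hNC.continuous.aestronglyMeasurable
      (Filter.Eventually.of_forall fun x => ?_)
    rw [Real.norm_of_nonneg (hN0 x).le]
    exact hM x
  set p : ℝ := 1 / ((n : ℝ) - 2) with hp
  set g : EuclideanSpace ℝ (Fin n) → ℝ := fun x => N x ^ p with hg
  have hg0 : ∀ x, 0 < g x := fun x => Real.rpow_pos_of_pos (hN0 x) p
  have hgC : ContDiff ℝ 1 g := hNC.rpow_const_of_ne fun x => (hN0 x).ne'
  have hgN : ∀ x, g x ^ (n - 2) = N x := fun x => by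
    rw [hg]
    simp only
    rw [← Real.rpow_natCast, ← Real.rpow_mul (hN0 x).le, hcast, hp, one_div_mul_cancel hn2.ne',
      Real.rpow_one]
  have hgn : ∀ x, g x ^ n = N x * g x ^ 2 := fun x => by
    rw [← hgN x, ← pow_add]; congr 1; omega
  have hgM : ∀ x, g x ^ n ≤ M * (M ^ p) ^ 2 * w x := fun x => by
    have h1 : g x ≤ M ^ p := Real.rpow_le_rpow (hN0 x).le
      ((hM x).trans (mul_le_of_le_one_right hM0.le (hw1 x))) (by positivity)
    rw [hgn]
    calc N x * g x ^ 2 ≤ (M * w x) * (M ^ p) ^ 2 :=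
          mul_le_mul (hM x) (pow_le_pow_left₀ (hg0 x).le h1 2) (by positivity)
            (mul_nonneg hM0.le (hw0 x).le)
      _ = _ := by ring
  have hgni : Integrable fun x => g x ^ n := by
    refine (hZi.const_mul (M * (M ^ p) ^ 2)).mono' (hgC.continuous.pow n).aestronglyMeasurable
      (Filter.Eventually.of_forall fun x => ?_)
    rw [Real.norm_of_nonneg (pow_pos (hg0 x) n).le]
    exact hgM x
  have hdN : ∀ x, ‖fderiv ℝ N x‖ ≤ 2 * (|f x| * ‖fderiv ℝ f x‖ + ε * w x * n) := by
    intro x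
    have h1 := ((hf.differentiable one_ne_zero x).hasFDerivAt.pow 2).add
      ((hasFDerivAt_inv_one_add_norm_sq_pow x).const_mul ε)
    have h2 : fderiv ℝ N x = _ := h1.fderiv
    rw [h2]
    refine (norm_add_le _ _).trans ?_
    rw [norm_smul (2 • f x ^ (2 - 1)), norm_smul ε, norm_smul (-_), innerSL_apply_norm]
    have e1 : ‖x‖ / (1 + ‖x‖ ^ 2) ≤ 1 := by
      rw [div_le_one (hW x)]
      nlinarith [sq_nonneg (‖x‖ - 1), norm_nonneg x]
    have hw0x : 0 < ((1 + ‖x‖ ^ 2) ^ n)⁻¹ := hw0 x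
    rw [norm_neg, Real.norm_of_nonneg hε.le, Real.norm_of_nonneg
      (show 0 ≤ 2 * n * ((1 + ‖x‖ ^ 2) ^ n)⁻¹ / (1 + ‖x‖ ^ 2) by positivity)]
    have e2 : ε * (2 * n * ((1 + ‖x‖ ^ 2) ^ n)⁻¹ / (1 + ‖x‖ ^ 2) * ‖x‖)
        = 2 * (ε * w x * n) * (‖x‖ / (1 + ‖x‖ ^ 2)) := by rw [hw]; ring
    have e3 := mul_le_of_le_one_right (show 0 ≤ 2 * (ε * w x * n) by
      have := hw0 x; positivity) e1
    rw [e2]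
    have e4 : ‖(2 • f x ^ (2 - 1) : ℝ)‖ = 2 * |f x| := by simp
    rw [e4]
    linarith
  have hid : ∀ x, g x ^ n * (‖fderiv ℝ g x‖ / g x ^ 2) ^ 2
      = ‖fderiv ℝ N x‖ ^ 2 / (N x * ((n : ℝ) - 2) ^ 2) := by
    intro x
    have h1 := (hNC.differentiable one_ne_zero x).hasFDerivAt.rpow_const (p := p)
      (Or.inl (hN0 x).ne')
    have h2 : fderiv ℝ g x = _ := h1.fderiv
    have h3 : N x ^ (p - 1) = g x / N x := by rw [Real.rpow_sub_one (hN0 x).ne']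
    have := hN0 x
    have := hg0 x
    rw [hgn, h2, h3, norm_smul, Real.norm_of_nonneg (by positivity), hp]
    field_simp
  have hDb : ∀ x, g x ^ n * (‖fderiv ℝ g x‖ / g x ^ 2) ^ 2
      ≤ 4 / ((n : ℝ) - 2) ^ 2 * (‖fderiv ℝ f x‖ ^ 2 + ε * n ^ 2 * w x) := by
    intro x
    rw [hid, div_le_iff₀ (by have := hN0 x; positivity)]
    have h1 := pow_le_pow_left₀ (norm_nonneg _) (hdN x) 2
    refine h1.trans ?_
    have e : 4 / ((n : ℝ) - 2) ^ 2 * (‖fderiv ℝ f x‖ ^ 2 + ε * n ^ 2 * w x) *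
        (N x * ((n : ℝ) - 2) ^ 2) = 4 * (‖fderiv ℝ f x‖ ^ 2 + ε * n ^ 2 * w x) * N x := by
      field_simp
    rw [e, hN]
    simp only
    rw [← sq_abs (f x)]
    have h2 : 0 ≤ ε * w x * (|f x| * n - ‖fderiv ℝ f x‖) ^ 2 := by
      have := hw0 x
      positivity
    linarith
  have hfD : Integrable fun x => ‖fderiv ℝ f x‖ ^ 2 := by
    refine Continuous.integrable_of_hasCompactSupport
      ((hf.continuous_fderiv one_ne_zero).norm.pow 2) ?_
    exact (hfc.fderiv ℝ).comp_left (g := fun t => ‖t‖ ^ 2) (by simp)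
  have hbi : Integrable fun x => 4 / ((n : ℝ) - 2) ^ 2 *
      (‖fderiv ℝ f x‖ ^ 2 + ε * n ^ 2 * w x) := (hfD.add (hZi.const_mul _)).const_mul _
  have hDi : Integrable fun x => g x ^ n * (‖fderiv ℝ g x‖ / g x ^ 2) ^ 2 := by
    have hgc := hgC.continuous
    have hgd := (hgC.continuous_fderiv one_ne_zero).norm
    refine hbi.mono' (Continuous.aestronglyMeasurable ?_)
      (Filter.Eventually.of_forall fun x => ?_)
    · exact (hgc.pow n).mul ((hgd.div (hgc.pow 2) fun x => (pow_pos (hg0 x) 2).ne').pow 2)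
    · rw [Real.norm_of_nonneg (by have := hg0 x; positivity)]
      exact hDb x
  set m := ∫ x, g x ^ n with hm
  set I := ∫ x, |f x| ^ (2 * n / ((n : ℝ) - 2)) with hI
  have hI0 : 0 ≤ I := integral_nonneg fun x => by positivity
  have hIm : I ≤ m := by
    refine integral_mono_of_nonneg (Filter.Eventually.of_forall fun x => ?_) hgni
      (Filter.Eventually.of_forall fun x => ?_)
    · simp only [Pi.zero_apply]
      positivity
    · have h1 : |f x| ^ (2 * n / ((n : ℝ) - 2)) = (f x ^ 2) ^ (p * n) := by
        rw [← sq_abs, ← Real.rpow_natCast |f x| 2, ← Real.rpow_mul (abs_nonneg _)]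
        congr 1
        rw [hp]
        push_cast
        ring
      have h2 : g x ^ n = N x ^ (p * n) := by
        rw [Real.rpow_mul (hN0 x).le, Real.rpow_natCast]
      simp only
      rw [h1, h2]
      refine Real.rpow_le_rpow (by positivity) ?_ (by positivity)
      have := hw0 x
      rw [hN]
      simp only
      have : 0 < ε * w x := by positivity
      linarith
  have hm0 : 0 < m := by
    rw [hm, integral_pos_iff_support_of_nonneg (fun x => (pow_pos (hg0 x) n).le) hgni]
    have : Function.support (fun x => g x ^ n) = Set.univ :=
      Set.eq_univ_of_forall fun x => (pow_pos (hg0 x) n).ne'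
    rw [this]
    exact isOpen_univ.measure_pos _ Set.univ_nonempty
  have hmain := sobolev_of_pos hn hgC hg0
    ⟨M * (M ^ p) ^ 2, fun x => (hgM x).trans
      (mul_le_mul_of_nonneg_left (inv_pow_le_prod_inv x) (by positivity))⟩
    (by simp_rw [hgN]; exact hNi) hDi (k := (m / Z) ^ (1 / (n : ℝ))) (by positivity) hZi hYi hZ rfl
    (by rw [hYZ, hZ])
    (by
      rw [← Real.rpow_natCast, ← Real.rpow_mul (by positivity), one_div_mul_cancel (by linarith),
        Real.rpow_one, div_mul_cancel₀ _ hZ0.ne'])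
  have h1 : ((m / Z) ^ (1 / (n : ℝ))) ^ (n - 2) = (m / Z) ^ (((n : ℝ) - 2) / n) := by
    rw [← Real.rpow_natCast, ← Real.rpow_mul (by positivity), hcast]
    congr 1
    ring
  have h2 := integral_mono hDi hbi hDb
  rw [integral_const_mul, integral_add hfD (hZi.const_mul _), integral_const_mul, hZ] at h2
  rw [h1] at hmain
  have h3 : (I / Z) ^ (((n : ℝ) - 2) / n) ≤ (m / Z) ^ (((n : ℝ) - 2) / n) :=
    Real.rpow_le_rpow (by positivity) (by gcongr) (by positivity)
  have h4 := hmain.trans (mul_le_mul_of_nonneg_left h2 hn2.le)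
  have h5 : ((n : ℝ) - 2) * (4 / ((n : ℝ) - 2) ^ 2 *
      ((∫ x, ‖fderiv ℝ f x‖ ^ 2) + ε * n ^ 2 * Z))
      = 4 / ((n : ℝ) - 2) * ((∫ x, ‖fderiv ℝ f x‖ ^ 2) + ε * n ^ 2 * Z) := by
    field_simp
  rw [h5, div_mul_eq_mul_div, le_div_iff₀ hn2] at h4
  have h6 : (n : ℝ) * (n - 2) * ((I / Z) ^ (((n : ℝ) - 2) / n) * Z) ≤
      (n : ℝ) * (n - 2) * ((m / Z) ^ (((n : ℝ) - 2) / n) * Z) := by gcongr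
  linarith

/-- Sharp Sobolev inequality on `ℝⁿ`. -/
theorem sobolev_sharp {n : ℕ} (hn : 3 ≤ n) {f : EuclideanSpace ℝ (Fin n) → ℝ}
    (hf : ContDiff ℝ 1 f) (hfc : HasCompactSupport f) :
    (n : ℝ) * (n - 2) / 4 * sphereVol n ^ (2 / (n : ℝ)) *
      (∫ x, |f x| ^ (2 * n / ((n : ℝ) - 2))) ^ (((n : ℝ) - 2) / n) ≤ ∫ x, ‖fderiv ℝ f x‖ ^ 2 := by
  have hn' : (3 : ℝ) ≤ n := by exact_mod_cast hn
  obtain ⟨-, -, hZ, -⟩ := integral_inv_one_add_norm_sq_pow hn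
  set Z := ∫ y : EuclideanSpace ℝ (Fin n), ((1 + ‖y‖ ^ 2) ^ n)⁻¹ with hZd
  have hpi := Real.pi_pos
  have hZ0 : 0 < Z := by
    have h1 : 0 < sphereVol n := by
      rw [sphereVol_eq]
      have := Real.Gamma_pos_of_pos (show 0 < ((n : ℝ) + 1) / 2 by positivity)
      positivity
    rw [← hZ] at h1
    exact pos_of_mul_pos_right h1 (by positivity)
  have h : (n : ℝ) * (n - 2) * (((∫ x, |f x| ^ (2 * n / ((n : ℝ) - 2))) / Z) ^
      (((n : ℝ) - 2) / n) * Z) ≤ ∫ x, ‖fderiv ℝ f x‖ ^ 2 := by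
    refine le_of_forall_pos_le_add fun δ hδ => ?_
    have := sobolev_of_regularization hn hf hfc hZ0 rfl
      (ε := δ / (n ^ 2 * Z)) (by positivity)
    rwa [div_mul_cancel₀ _ (by positivity)] at this
  refine le_trans (le_of_eq ?_) h
  have hI0 : 0 ≤ ∫ x, |f x| ^ (2 * n / ((n : ℝ) - 2)) := integral_nonneg fun x => by positivity
  have hs : sphereVol n ^ (2 / (n : ℝ)) = 4 * Z ^ (2 / (n : ℝ)) := by
    rw [← hZ, Real.mul_rpow (by positivity) hZ0.le, ← Real.rpow_natCast, ← Real.rpow_mul two_pos.le,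
      mul_div_cancel₀ _ (by positivity)]
    norm_num
  have hz : Z ^ (2 / (n : ℝ)) * Z ^ (((n : ℝ) - 2) / n) = Z := by
    rw [← Real.rpow_add hZ0, ← add_div, add_sub_cancel, div_self (by positivity), Real.rpow_one]
  rw [hs, Real.div_rpow hI0 hZ0.le]
  have hp : 0 < Z ^ (((n : ℝ) - 2) / n) := by positivity
  generalize Z ^ (((n : ℝ) - 2) / n) = q at hz hp ⊢
  generalize Z ^ (2 / (n : ℝ)) = r at hz ⊢
  rw [← hz]
  field_simp

theorem continuous_mul_of_tsupport {X : Type*} [TopologicalSpace X] {f g : X → ℝ}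
    (hf : Continuous f) (hg : ∀ x ∈ tsupport f, ContinuousAt g x) :
    Continuous fun x => f x * g x := by
  refine continuous_iff_continuousAt.2 fun x => ?_
  by_cases hx : x ∈ tsupport f
  · exact hf.continuousAt.mul (hg x hx)
  · have h0 : (fun y => f y * g y) =ᶠ[nhds x] fun _ => 0 := by
      filter_upwards [notMem_tsupport_iff_eventuallyEq.1 hx] with y hy
      simp [hy]
    exact continuousAt_const.congr h0.symm

theorem contDiff_mul_of_tsupport {E : Type*} [NormedAddCommGroup E] [NormedSpace ℝ E]
    {f g : E → ℝ} {k : WithTop ℕ∞} (hf : ContDiff ℝ k f)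
    (hg : ∀ x ∈ tsupport f, ContDiffAt ℝ k g x) :
    ContDiff ℝ k fun x => f x * g x := by
  refine contDiff_iff_contDiffAt.2 fun x => ?_
  by_cases hx : x ∈ tsupport f
  · exact hf.contDiffAt.mul (hg x hx)
  · have h0 : (fun y => f y * g y) =ᶠ[nhds x] fun _ => 0 := by
      filter_upwards [notMem_tsupport_iff_eventuallyEq.1 hx] with y hy
      simp [hy]
    exact contDiffAt_const.congr_of_eventuallyEq h0

theorem hasFDerivAt_comp_norm_sq {E : Type*} [NormedAddCommGroup E] [InnerProductSpace ℝ E]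
    {m : ℝ → ℝ} {m' : ℝ} {x : E} (h : HasDerivAt m m' (‖x‖ ^ 2)) :
    HasFDerivAt (fun y => m (‖y‖ ^ 2)) ((2 * m') • innerSL ℝ x) x := by
  refine (h.comp_hasFDerivAt x (hasStrictFDerivAt_norm_sq x).hasFDerivAt).congr_fderiv ?_
  ext v
  simp only [smul_apply, smul_eq_mul, nsmul_eq_mul]
  push_cast
  ring

theorem integral_fderiv_self_add {n : ℕ} {u : EuclideanSpace ℝ (Fin n) → ℝ} (hu : ContDiff ℝ 1 u)
    (huc : HasCompactSupport u) :
    (Integrable fun x => fderiv ℝ u x x + n * u x) ∧ ∫ x, fderiv ℝ u x x + n * u x = 0 := by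
  have hui : Integrable u := hu.continuous.integrable_of_hasCompactSupport huc
  have hdc : Continuous fun x => fderiv ℝ u x := hu.continuous_fderiv one_ne_zero
  have hds : HasCompactSupport fun x => fderiv ℝ u x := huc.fderiv ℝ
  have hi : ∀ i : Fin n, Integrable fun x => x i * fderiv ℝ u x (EuclideanSpace.single i 1) := by
    intro i
    have h1 : HasCompactSupport fun x => fderiv ℝ u x (EuclideanSpace.single i 1) :=
      huc.fderiv_apply ℝ _
    have h2 : Continuous fun x => fderiv ℝ u x (EuclideanSpace.single i 1) :=
      hdc.clm_apply continuous_const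
    exact Continuous.integrable_of_hasCompactSupport (by fun_prop) h1.mul_left
  have hp : ∀ i : Fin n, ∫ x : EuclideanSpace ℝ (Fin n),
      x i * fderiv ℝ u x (EuclideanSpace.single i 1) = -∫ x, u x := by
    intro i
    have hd : ∀ x : EuclideanSpace ℝ (Fin n), HasFDerivAt
        (fun y : EuclideanSpace ℝ (Fin n) => y i) (EuclideanSpace.proj (𝕜 := ℝ) i) x := fun x =>
      (EuclideanSpace.proj (𝕜 := ℝ) i).hasFDerivAt
    have e : ∀ x : EuclideanSpace ℝ (Fin n),
        fderiv ℝ (fun y : EuclideanSpace ℝ (Fin n) => y i) x (EuclideanSpace.single i 1) = 1 := by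
      intro x
      rw [(hd x).fderiv]
      simp
    rw [integral_mul_fderiv_eq_neg_fderiv_mul_of_integrable]
    · simp_rw [e, one_mul]
    · simp_rw [e, one_mul]
      exact hui
    · exact hi i
    · exact Continuous.integrable_of_hasCompactSupport
        (by have := hu.continuous; fun_prop) huc.mul_left
    · exact fun x _ => (hd x).differentiableAt
    · exact fun x _ => hu.differentiable one_ne_zero x
  have e1 : ∀ x, fderiv ℝ u x x = ∑ i, x i * fderiv ℝ u x (EuclideanSpace.single i 1) := by
    intro x
    have h := congrArg (fderiv ℝ u x) ((EuclideanSpace.basisFun (Fin n) ℝ).sum_repr x)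
    rw [map_sum] at h
    rw [← h]
    simp
  simp_rw [e1]
  refine ⟨(integrable_finsetSum _ fun i _ => hi i).add (hui.const_mul _), ?_⟩
  rw [integral_add (integrable_finsetSum _ fun i _ => hi i) (hui.const_mul _),
    integral_finsetSum _ fun i _ => hi i, integral_const_mul]
  simp [hp]

/-- The divergence theorem for the field `φ² M(|x|²) x`. -/
theorem integral_div_radial {n : ℕ} {φ : EuclideanSpace ℝ (Fin n) → ℝ} (hφ : ContDiff ℝ 1 φ)
    (hφc : HasCompactSupport φ) (hφs : tsupport φ ⊆ Metric.ball 0 1) {M M' : ℝ → ℝ}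
    (hM : ∀ t, 0 ≤ t → t < 1 → ContDiffAt ℝ 1 M t)
    (hM' : ∀ t, 0 ≤ t → t < 1 → HasDerivAt M (M' t) t) :
    (Integrable fun x => 2 * φ x * M (‖x‖ ^ 2) * fderiv ℝ φ x x +
      φ x ^ 2 * (2 * ‖x‖ ^ 2 * M' (‖x‖ ^ 2) + n * M (‖x‖ ^ 2))) ∧
    ∫ x, 2 * φ x * M (‖x‖ ^ 2) * fderiv ℝ φ x x +
      φ x ^ 2 * (2 * ‖x‖ ^ 2 * M' (‖x‖ ^ 2) + n * M (‖x‖ ^ 2)) = 0 := by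
  have hb : ∀ x ∈ tsupport φ, ‖x‖ ^ 2 < 1 := fun x hx => by
    have := hφs hx
    rw [mem_ball_zero_iff] at this
    nlinarith [norm_nonneg x]
  have hsub : tsupport (fun x => φ x ^ 2) ⊆ tsupport φ :=
    closure_mono fun x hx h => hx (by simp [h])
  have hu : ContDiff ℝ 1 fun x => φ x ^ 2 * M (‖x‖ ^ 2) :=
    contDiff_mul_of_tsupport (hφ.pow 2) fun x hx =>
      (hM _ (by positivity) (hb x (hsub hx))).comp x (contDiff_norm_sq ℝ).contDiffAt
  have huc : HasCompactSupport fun x => φ x ^ 2 * M (‖x‖ ^ 2) :=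
    (hφc.comp_left (g := fun t : ℝ => t ^ 2) (by simp)).mul_right
  have e : ∀ x, fderiv ℝ (fun x => φ x ^ 2 * M (‖x‖ ^ 2)) x x + n * (φ x ^ 2 * M (‖x‖ ^ 2))
      = 2 * φ x * M (‖x‖ ^ 2) * fderiv ℝ φ x x +
        φ x ^ 2 * (2 * ‖x‖ ^ 2 * M' (‖x‖ ^ 2) + n * M (‖x‖ ^ 2)) := by
    intro x
    by_cases hx : x ∈ tsupport φ
    · have h1 := ((hφ.differentiable one_ne_zero x).hasFDerivAt.pow 2).mul
        (hasFDerivAt_comp_norm_sq (hM' _ (by positivity) (hb x hx)))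
      have h2 : fderiv ℝ (fun x => φ x ^ 2 * M (‖x‖ ^ 2)) x = _ := h1.fderiv
      rw [h2]
      simp only [add_apply, smul_apply, smul_eq_mul, nsmul_eq_mul, innerSL_apply_apply,
        real_inner_self_eq_norm_sq]
      push_cast
      ring
    · have h0 : φ x = 0 := image_eq_zero_of_notMem_tsupport hx
      have h1 : (fun x => φ x ^ 2 * M (‖x‖ ^ 2)) =ᶠ[nhds x] fun _ => 0 := by
        filter_upwards [notMem_tsupport_iff_eventuallyEq.1 hx] with y hy
        simp [hy]
      rw [h1.fderiv_eq]
      simp [h0]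
  have := integral_fderiv_self_add hu huc
  simp_rw [e] at this
  exact this

theorem norm_add_smul_innerSL_sq {E : Type*} [NormedAddCommGroup E] [InnerProductSpace ℝ E]
    [CompleteSpace E] (l : E →L[ℝ] ℝ) (c : ℝ) (x : E) :
    ‖l + c • innerSL ℝ x‖ ^ 2 = ‖l‖ ^ 2 + 2 * c * l x + c ^ 2 * ‖x‖ ^ 2 := by
  obtain ⟨v, rfl⟩ : ∃ v, innerSL ℝ v = l :=
    ⟨(InnerProductSpace.toDual ℝ E).symm l, (InnerProductSpace.toDual ℝ E).apply_symm_apply l⟩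
  rw [← map_smul, ← map_add, innerSL_apply_norm, innerSL_apply_norm, norm_add_sq_real, norm_smul,
    inner_smul_right, innerSL_apply_apply, mul_pow, Real.norm_eq_abs, sq_abs]
  ring

theorem one_sub_norm_sq_pos {E : Type*} [SeminormedAddCommGroup E] {x : E}
    (hx : x ∈ Metric.ball (0 : E) 1) : 0 < 1 - ‖x‖ ^ 2 := by
  rw [mem_ball_zero_iff] at hx
  nlinarith [norm_nonneg x]

theorem lam_pos {n : ℕ} {x : EuclideanSpace ℝ (Fin n)} (hx : x ∈ Metric.ball 0 1) : 0 < lam x :=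
  div_pos two_pos (one_sub_norm_sq_pos hx)

theorem two_div_one_sub_norm_sq_sq {n : ℕ} (x : EuclideanSpace ℝ (Fin n)) :
    2 / (1 - ‖x‖ ^ 2) ^ 2 = lam x ^ 2 / 2 := by
  rw [lam, div_pow]
  generalize (1 - ‖x‖ ^ 2) ^ 2 = d
  ring

theorem hasDerivAt_two_div_one_sub {t : ℝ} (ht : t < 1) :
    HasDerivAt (fun t : ℝ => 2 / (1 - t)) (2 / (1 - t) ^ 2) t := by
  have h : 1 - t ≠ 0 := (sub_pos.2 ht).ne'
  refine ((hasDerivAt_const t (2 : ℝ)).div ((hasDerivAt_id t).const_sub 1) h).congr_deriv ?_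
  simp

theorem contDiffAt_two_div_one_sub {t : ℝ} (ht : t < 1) :
    ContDiffAt ℝ 1 (fun t : ℝ => 2 / (1 - t)) t :=
  contDiffAt_const.div (contDiffAt_const.sub contDiffAt_id) (sub_pos.2 ht).ne'

theorem integrable_energy {n : ℕ} {φ : EuclideanSpace ℝ (Fin n) → ℝ} (hφ : ContDiff ℝ 1 φ)
    (hφc : HasCompactSupport φ) (hφs : tsupport φ ⊆ Metric.ball 0 1) (k : ℕ) :
    Integrable fun x => ‖fderiv ℝ φ x‖ ^ 2 * lam x ^ k := by
  have hsub : tsupport (fun x => ‖fderiv ℝ φ x‖ ^ 2) ⊆ tsupport φ :=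
    (tsupport_comp_subset (g := fun l : EuclideanSpace ℝ (Fin n) →L[ℝ] ℝ => ‖l‖ ^ 2) (by simp)
      (fderiv ℝ φ)).trans (tsupport_fderiv_subset ℝ)
  refine Continuous.integrable_of_hasCompactSupport (continuous_mul_of_tsupport
    ((hφ.continuous_fderiv one_ne_zero).norm.pow 2) fun x hx => ?_) ?_
  · have h := one_sub_norm_sq_pos (hφs (hsub hx))
    have hl : ContinuousAt (lam (n := n)) x := by
      unfold lam
      exact continuousAt_const.div (by fun_prop) h.ne'
    exact hl.pow k
  · exact ((hφc.fderiv ℝ).comp_left (g := fun t => ‖t‖ ^ 2) (by simp)).mul_right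

/-- The conformal substitution `f = φ λ^((n - 2) / 2)` does not increase the energy. -/
theorem integral_conformal_le {n : ℕ} (hn : 3 ≤ n) {φ : EuclideanSpace ℝ (Fin n) → ℝ}
    (hφ : ContDiff ℝ 1 φ) (hφc : HasCompactSupport φ) (hφs : tsupport φ ⊆ Metric.ball 0 1) :
    ContDiff ℝ 1 (fun x => φ x * lam x ^ (((n : ℝ) - 2) / 2)) ∧
    ∫ x, ‖fderiv ℝ (fun x => φ x * lam x ^ (((n : ℝ) - 2) / 2)) x‖ ^ 2 ≤
      ∫ x, ‖fderiv ℝ φ x‖ ^ 2 * lam x ^ (n - 2) := by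
  have hn' : (3 : ℝ) ≤ n := by exact_mod_cast hn
  set a : ℝ := ((n : ℝ) - 2) / 2 with ha
  have ha0 : 0 < a := by rw [ha]; linarith
  have hb : ∀ x ∈ tsupport φ, ‖x‖ ^ 2 < 1 := fun x hx =>
    sub_pos.1 (one_sub_norm_sq_pos (hφs hx))
  set f : EuclideanSpace ℝ (Fin n) → ℝ := fun x => φ x * lam x ^ a with hf
  have hfC : ContDiff ℝ 1 f := contDiff_mul_of_tsupport hφ fun x hx => by
    have h1 := (contDiffAt_two_div_one_sub (hb x hx)).rpow_const_of_ne (p := a)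
      (lam_pos (hφs hx)).ne'
    exact h1.comp x (contDiff_norm_sq ℝ).contDiffAt
  have hfc : HasCompactSupport f := hφc.mul_right
  refine ⟨hfC, ?_⟩
  obtain ⟨hIi, hI⟩ := integral_div_radial hφ hφc hφs (M := fun t => a * (2 / (1 - t)) ^ (n - 1))
    (M' := fun t => a * (((n - 1 : ℕ) : ℝ) * (2 / (1 - t)) ^ (n - 1 - 1) * (2 / (1 - t) ^ 2)))
    (fun t _ ht => contDiffAt_const.mul ((contDiffAt_two_div_one_sub ht).pow _))
    (fun t _ ht => ((hasDerivAt_two_div_one_sub ht).pow _).const_mul a)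
  have hE := integrable_energy hφ hφc hφs (n - 2)
  have hfi : Integrable fun x => ‖fderiv ℝ f x‖ ^ 2 :=
    Continuous.integrable_of_hasCompactSupport ((hfC.continuous_fderiv one_ne_zero).norm.pow 2)
      ((hfc.fderiv ℝ).comp_left (g := fun t => ‖t‖ ^ 2) (by simp))
  have key := integral_mono hfi (hE.add hIi) fun x => ?_
  · rwa [integral_add' hE hIi, hI, add_zero] at key
  simp only [Pi.add_apply]
  by_cases hx : x ∈ tsupport φ
  · have hΛ := lam_pos (hφs hx)
    have h1 := (hφ.differentiable one_ne_zero x).hasFDerivAt.mul (hasFDerivAt_comp_norm_sq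
      ((hasDerivAt_two_div_one_sub (hb x hx)).rpow_const (p := a) (Or.inl hΛ.ne')))
    have h2 : fderiv ℝ f x = _ := h1.fderiv
    have hL : lam x ^ (a - 1) = lam x ^ a / lam x := Real.rpow_sub_one hΛ.ne' a
    have hL2 : (lam x ^ a) ^ 2 = lam x ^ (n - 2) := by
      rw [← Real.rpow_natCast, ← Real.rpow_mul hΛ.le, ← Real.rpow_natCast,
        Nat.cast_sub (by omega)]
      congr 1
      rw [ha]
      push_cast
      ring
    have hLp : 0 < lam x ^ a := Real.rpow_pos_of_pos hΛ a
    have hd : 2 / (1 - ‖x‖ ^ 2) ^ 2 = lam x ^ 2 / 2 := two_div_one_sub_norm_sq_sq x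
    have h3 : fderiv ℝ f x = (lam x ^ a) • (fderiv ℝ φ x + (φ x * a * lam x) • innerSL ℝ x) := by
      rw [h2]
      change φ x • (2 * (2 / (1 - ‖x‖ ^ 2) ^ 2 * a * lam x ^ (a - 1))) • innerSL ℝ x +
        (lam x ^ a) • fderiv ℝ φ x = _
      rw [hd, hL, smul_add, smul_smul, smul_smul, add_comm]
      congr 2
      field_simp
    rw [h3, norm_smul, mul_pow, norm_add_smul_innerSL_sq, Real.norm_of_nonneg hLp.le, hL2]
    change _ ≤ _ + (2 * φ x * (a * lam x ^ (n - 1)) * fderiv ℝ φ x x + φ x ^ 2 * (2 * ‖x‖ ^ 2 *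
      (a * (((n - 1 : ℕ) : ℝ) * lam x ^ (n - 1 - 1) * (2 / (1 - ‖x‖ ^ 2) ^ 2))) +
        n * (a * lam x ^ (n - 1))))
    have hp1 : lam x ^ (n - 1) = lam x ^ (n - 2) * lam x := by rw [← pow_succ]; congr 1; omega
    have hc : ((n - 1 : ℕ) : ℝ) = 2 * a + 1 := by
      rw [Nat.cast_sub (by omega), ha]; push_cast; ring
    have hP : 0 < lam x ^ (n - 2) := pow_pos hΛ _
    rw [hd, hp1, show n - 1 - 1 = n - 2 by omega, hc]
    have h4 : 0 ≤ lam x ^ (n - 2) * φ x ^ 2 * (a * (a + 1) * lam x ^ 2 * ‖x‖ ^ 2 +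
      n * a * lam x) := by positivity
    linarith
  · have h0 : φ x = 0 := image_eq_zero_of_notMem_tsupport hx
    have h1 : f =ᶠ[nhds x] fun _ => 0 := by
      filter_upwards [notMem_tsupport_iff_eventuallyEq.1 hx] with y hy
      simp [hf, hy]
    rw [h1.fderiv_eq, fderiv_of_notMem_tsupport ℝ hx, h0]
    simp

/-- Hardy inequality with the weight `1 / d²` replaced by a bounded minorant. -/
theorem hardy_regularized {n : ℕ} (hn : 3 ≤ n) {φ : EuclideanSpace ℝ (Fin n) → ℝ}
    (hφ : ContDiff ℝ 1 φ) (hφc : HasCompactSupport φ) (hφs : tsupport φ ⊆ Metric.ball 0 1)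
    {δ : ℝ} (hδ : 0 < δ) :
    ∫⁻ x, ENNReal.ofReal ((((n : ℝ) - 2) / 2) ^ 2 *
      (φ x ^ 2 * lam x ^ n * (‖x‖ ^ 2 / (4 * (‖x‖ ^ 2 + δ) ^ 2)))) ≤
      ENNReal.ofReal (∫ x, ‖fderiv ℝ φ x‖ ^ 2 * lam x ^ (n - 2)) := by
  have hn' : (3 : ℝ) ≤ n := by exact_mod_cast hn
  set c : ℝ := ((n : ℝ) - 2) / 2 with hc
  have hc0 : 0 < c := by rw [hc]; linarith
  have hE := integrable_energy hφ hφc hφs (n - 2)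
  have hd : ∀ t : ℝ, 0 ≤ t → 2 * (t + δ) ≠ 0 := fun t ht => by positivity
  obtain ⟨hIi, hI⟩ := integral_div_radial hφ hφc hφs
    (M := fun t => c * (2 / (1 - t)) ^ (n - 1) / (2 * (t + δ)))
    (M' := fun t => (c * (((n - 1 : ℕ) : ℝ) * (2 / (1 - t)) ^ (n - 1 - 1) * (2 / (1 - t) ^ 2)) *
      (2 * (t + δ)) - c * (2 / (1 - t)) ^ (n - 1) * (2 * 1)) / (2 * (t + δ)) ^ 2)
    (fun t h0 ht => (contDiffAt_const.mul ((contDiffAt_two_div_one_sub ht).pow _)).div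
      (contDiffAt_const.mul (contDiffAt_id.add contDiffAt_const)) (hd t h0))
    (fun t h0 ht => (((hasDerivAt_two_div_one_sub ht).pow _).const_mul c).div
      (((hasDerivAt_id t).add_const δ).const_mul 2) (hd t h0))
  have hle : ∀ x, c ^ 2 * (φ x ^ 2 * lam x ^ n * (‖x‖ ^ 2 / (4 * (‖x‖ ^ 2 + δ) ^ 2))) ≤
      ‖fderiv ℝ φ x‖ ^ 2 * lam x ^ (n - 2) + (2 * φ x *
      (c * lam x ^ (n - 1) / (2 * (‖x‖ ^ 2 + δ))) * fderiv ℝ φ x x +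
      φ x ^ 2 * (2 * ‖x‖ ^ 2 * ((c * (((n - 1 : ℕ) : ℝ) * lam x ^ (n - 1 - 1) *
      (2 / (1 - ‖x‖ ^ 2) ^ 2)) * (2 * (‖x‖ ^ 2 + δ)) - c * lam x ^ (n - 1) * (2 * 1)) /
      (2 * (‖x‖ ^ 2 + δ)) ^ 2) + n * (c * lam x ^ (n - 1) / (2 * (‖x‖ ^ 2 + δ))))) := by
    intro x
    by_cases hx : x ∈ tsupport φ
    · have hΛ := lam_pos (hφs hx)
      have h1t := one_sub_norm_sq_pos (hφs hx)
      have hd : 2 / (1 - ‖x‖ ^ 2) ^ 2 = lam x ^ 2 / 2 := two_div_one_sub_norm_sq_sq x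
      have hp1 : lam x ^ (n - 1) = lam x ^ (n - 2) * lam x := by rw [← pow_succ]; congr 1; omega
      have hp2 : lam x ^ n = lam x ^ (n - 2) * lam x ^ 2 := by rw [← pow_add]; congr 1; omega
      have hcn : ((n - 1 : ℕ) : ℝ) = 2 * c + 1 := by
        rw [Nat.cast_sub (by omega), hc]; push_cast; ring
      have hnc : (n : ℝ) = 2 * c + 2 := by rw [hc]; ring
      have hP : 0 < lam x ^ (n - 2) := pow_pos hΛ _
      rw [hd, hp1, hp2, show n - 1 - 1 = n - 2 by omega, hcn, hnc]
      set h := 1 / (2 * (‖x‖ ^ 2 + δ)) with hh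
      have hsq := norm_add_smul_innerSL_sq (fderiv ℝ φ x) (c * φ x * lam x * h) x
      have hsq0 := mul_nonneg hP.le (hsq ▸ sq_nonneg ‖fderiv ℝ φ x + (c * φ x * lam x * h) •
        innerSL ℝ x‖)
      have hΛe : lam x * (1 - ‖x‖ ^ 2) = 2 := by rw [lam]; field_simp
      have hhe : h * (2 * (‖x‖ ^ 2 + δ)) = 1 := by rw [hh]; field_simp
      have hh0 : 0 < h := by positivity
      generalize hlx : lam x = Λ at *
      generalize Λ ^ (n - 2) = P at *
      have ht0 : 0 ≤ ‖x‖ ^ 2 := by positivity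
      generalize ‖x‖ ^ 2 = t at *
      have e1 : t / (4 * (t + δ) ^ 2) = h ^ 2 * t := by rw [hh]; field_simp; norm_num
      have e2 : c * (P * Λ) / (2 * (t + δ)) = c * P * Λ * h := by rw [hh]; field_simp
      have e3 : (c * ((2 * c + 1) * P * (Λ ^ 2 / 2)) * (2 * (t + δ)) - c * (P * Λ) * (2 * 1)) /
          (2 * (t + δ)) ^ 2 = c * P * Λ * h * ((2 * c + 1) * Λ / 2 - 2 * h) := by
        rw [hh]; field_simp
      rw [e1, e2, e3]
      have hmain : 2 * c * Λ * h * t ≤ (2 * c + 2) + 2 * t * ((2 * c + 1) * Λ / 2 - 2 * h) := by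
        have hth : 2 * (h * t) ≤ 1 := by nlinarith [mul_pos hh0 hδ]
        have hΛ2 : 2 ≤ Λ := by nlinarith [mul_nonneg hΛ.le ht0]
        have hLt : Λ * t = Λ - 2 := by linarith
        have h1 := mul_le_mul_of_nonneg_left hth (mul_pos hc0 hΛ).le
        have h2 := mul_nonneg (add_pos hc0 one_pos).le (sub_nonneg.2 hΛ2)
        have e : 2 * t * ((2 * c + 1) * Λ / 2 - 2 * h) =
          (2 * c + 1) * (Λ * t) - 2 * (2 * (h * t)) := by ring
        rw [e, hLt]
        linarith
      have := mul_le_mul_of_nonneg_left hmain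
        (show 0 ≤ φ x ^ 2 * c * P * Λ * h by positivity)
      linarith
    · have h0 : φ x = 0 := image_eq_zero_of_notMem_tsupport hx
      rw [fderiv_of_notMem_tsupport ℝ hx, h0]
      simp
  have h0 : ∀ x, 0 ≤ c ^ 2 * (φ x ^ 2 * lam x ^ n * (‖x‖ ^ 2 / (4 * (‖x‖ ^ 2 + δ) ^ 2))) := by
    intro x
    by_cases hx : x ∈ tsupport φ
    · have hΛ := lam_pos (hφs hx)
      positivity
    · simp [image_eq_zero_of_notMem_tsupport hx]
  have hs := integral_add' hE hIi
  rw [hI, add_zero] at hs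
  rw [← hs, ofReal_integral_eq_lintegral_ofReal (hE.add hIi)
    (Filter.Eventually.of_forall fun x => (h0 x).trans (hle x))]
  exact lintegral_mono fun x => ENNReal.ofReal_le_ofReal (hle x)

theorem two_mul_norm_le_dH {n : ℕ} {x : EuclideanSpace ℝ (Fin n)} (hx : x ∈ Metric.ball 0 1) :
    2 * ‖x‖ ≤ dH x := by
  rw [mem_ball_zero_iff] at hx
  have h1 : 0 < 1 - ‖x‖ := by linarith
  have h0 := norm_nonneg x
  have h := Real.le_log_one_add_of_nonneg (x := 2 * ‖x‖ / (1 - ‖x‖)) (by positivity)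
  have e1 : 2 * (2 * ‖x‖ / (1 - ‖x‖)) / (2 * ‖x‖ / (1 - ‖x‖) + 2) = 2 * ‖x‖ := by
    have : 2 * ‖x‖ + 2 * (1 - ‖x‖) ≠ 0 := by linarith
    field_simp
    ring
  have e2 : 1 + 2 * ‖x‖ / (1 - ‖x‖) = (1 + ‖x‖) / (1 - ‖x‖) := by
    field_simp
    ring
  rwa [e1, e2] at h

/-- Hardy inequality in the Poincaré ball. -/
theorem hardy_hyperbolic {n : ℕ} (hn : 3 ≤ n) {φ : EuclideanSpace ℝ (Fin n) → ℝ}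
    (hφ : ContDiff ℝ 1 φ) (hφc : HasCompactSupport φ) (hφs : tsupport φ ⊆ Metric.ball 0 1) :
    ∫⁻ x, ENNReal.ofReal ((((n : ℝ) - 2) / 2) ^ 2 * (φ x ^ 2 / dH x ^ 2 * lam x ^ n)) ≤
      ENNReal.ofReal (∫ x, ‖fderiv ℝ φ x‖ ^ 2 * lam x ^ (n - 2)) := by
  set c : ℝ := ((n : ℝ) - 2) / 2 with hc
  set F : ℕ → EuclideanSpace ℝ (Fin n) → ENNReal := fun k x => ENNReal.ofReal (c ^ 2 *
      (φ x ^ 2 * lam x ^ n * (‖x‖ ^ 2 / (4 * (‖x‖ ^ 2 + 1 / ((k : ℝ) + 1)) ^ 2)))) with hF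
  have hm : Measurable φ := hφ.continuous.measurable
  have hlm : Measurable (lam (n := n)) := by
    unfold lam
    fun_prop
  have hlim : ∀ᵐ x, ENNReal.ofReal (c ^ 2 * (φ x ^ 2 / dH x ^ 2 * lam x ^ n)) ≤
      Filter.liminf (fun k => F k x) Filter.atTop := by
    have : Nonempty (Fin n) := ⟨⟨0, by omega⟩⟩
    filter_upwards [Measure.ae_ne volume (0 : EuclideanSpace ℝ (Fin n))] with x hx0
    by_cases hx : x ∈ tsupport φ
    · have hr : 0 < ‖x‖ := norm_pos_iff.2 hx0
      have ht : Filter.Tendsto (fun k => F k x) Filter.atTop (nhds (ENNReal.ofReal (c ^ 2 *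
          (φ x ^ 2 * lam x ^ n * (‖x‖ ^ 2 / (4 * (‖x‖ ^ 2 + 0) ^ 2)))))) := by
        refine ENNReal.tendsto_ofReal ((Filter.Tendsto.const_mul _
          (tendsto_const_nhds.div ?_ ?_)).const_mul _)
        · exact ((tendsto_one_div_add_atTop_nhds_zero_nat.const_add _).pow 2).const_mul 4
        · positivity
      rw [ht.liminf_eq]
      refine ENNReal.ofReal_le_ofReal (mul_le_mul_of_nonneg_left ?_ (by positivity))
      have hΛ := lam_pos (hφs hx)
      have hd := two_mul_norm_le_dH (hφs hx)
      rw [div_mul_eq_mul_div, div_eq_mul_inv]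
      refine mul_le_mul_of_nonneg_left ?_ (by positivity)
      have e : ‖x‖ ^ 2 / (4 * (‖x‖ ^ 2 + 0) ^ 2) = ((2 * ‖x‖) ^ 2)⁻¹ := by
        field_simp
        ring
      rw [e]
      exact inv_anti₀ (by positivity) (pow_le_pow_left₀ (by positivity) hd 2)
    · simp [image_eq_zero_of_notMem_tsupport hx]
  calc _ ≤ ∫⁻ x, Filter.liminf (fun k => F k x) Filter.atTop := lintegral_mono_ae hlim
    _ ≤ Filter.liminf (fun k => ∫⁻ x, F k x) Filter.atTop :=
        lintegral_liminf_le fun k => by rw [hF]; fun_prop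
    _ ≤ _ := Filter.liminf_le_of_le (by isBoundedDefault) fun b hb => by
        obtain ⟨k, hk⟩ := hb.exists
        exact hk.trans (hardy_regularized hn hφ hφc hφs Nat.one_div_pos_of_nat)

theorem norm_gradient_s6 {E : Type*} [NormedAddCommGroup E] [InnerProductSpace ℝ E] [CompleteSpace E]
    (f : E → ℝ) (x : E) : ‖gradient f x‖ = ‖fderiv ℝ f x‖ :=
  (InnerProductSpace.toDual ℝ E).symm.norm_map _

theorem setIntegral_energy {n : ℕ} (hn : 2 ≤ n) {φ : EuclideanSpace ℝ (Fin n) → ℝ}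
    (hφs : tsupport φ ⊆ Metric.ball 0 1) :
    ∫ x in Metric.ball (0 : EuclideanSpace ℝ (Fin n)) 1,
      ‖gradient φ x‖ ^ 2 * lam x ^ ((n : ℝ) - 2) = ∫ x, ‖fderiv ℝ φ x‖ ^ 2 * lam x ^ (n - 2) := by
  rw [← setIntegral_eq_integral_of_forall_compl_eq_zero (s := Metric.ball 0 1)
    (f := fun x => ‖fderiv ℝ φ x‖ ^ 2 * lam x ^ (n - 2)) fun x hx => by
    rw [fderiv_of_notMem_tsupport ℝ fun h => hx (hφs h)]; simp]
  refine setIntegral_congr_fun measurableSet_ball fun x _ => ?_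
  simp only [norm_gradient_s6]
  rw [← Real.rpow_natCast (lam x), Nat.cast_sub hn, Nat.cast_ofNat]

/-- The Hardy–Sobolev density is the geometric mean of the Hardy and Sobolev densities. -/
theorem hardy_sobolev_density {N s u d L : ℝ} (hN : 2 < N) (hu : 0 < u) (hd : 0 < d)
    (hL : 0 < L) :
    u ^ (2 * (N - s) / (N - 2)) / d ^ s * L =
      (u ^ 2 / d ^ 2 * L) ^ (s / 2) * (u ^ (2 * N / (N - 2)) * L) ^ (1 - s / 2) := by
  have hN2 : N - 2 ≠ 0 := by linarith
  have e1 : (u ^ 2) ^ (s / 2) = u ^ s := by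
    rw [← Real.rpow_natCast, ← Real.rpow_mul hu.le]; congr 1; push_cast; ring
  have e2 : (d ^ 2) ^ (s / 2) = d ^ s := by
    rw [← Real.rpow_natCast, ← Real.rpow_mul hd.le]; congr 1; push_cast; ring
  have e3 : u ^ (2 * (N - s) / (N - 2)) = u ^ s * (u ^ (2 * N / (N - 2))) ^ (1 - s / 2) := by
    rw [← Real.rpow_mul hu.le, ← Real.rpow_add hu]
    congr 1
    field_simp
    ring
  have e4 : L = L ^ (s / 2) * L ^ (1 - s / 2) := by
    rw [← Real.rpow_add hL, add_sub_cancel, Real.rpow_one]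
  rw [Real.mul_rpow (by positivity) hL.le, Real.mul_rpow (by positivity) hL.le,
    Real.div_rpow (by positivity) (by positivity), e1, e2, e3]
  nth_rewrite 1 [e4]
  ring

theorem hardy_sobolev_integral_le {n : ℕ} (hn : 3 ≤ n) {s : ℝ} (hs0 : 0 ≤ s) (hs2 : s ≤ 2)
    {φ : EuclideanSpace ℝ (Fin n) → ℝ} (hφ : ContDiff ℝ 1 φ) (hφc : HasCompactSupport φ)
    (hφs : tsupport φ ⊆ Metric.ball 0 1) :
    ∫ x in Metric.ball (0 : EuclideanSpace ℝ (Fin n)) 1,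
        |φ x| ^ (2 * ((n : ℝ) - s) / ((n : ℝ) - 2)) / dH x ^ s * lam x ^ (n : ℝ) ≤
      ((∫ x, ‖fderiv ℝ φ x‖ ^ 2 * lam x ^ (n - 2)) / (((n : ℝ) - 2) / 2) ^ 2) ^ (s / 2) *
      (∫ x, |φ x * lam x ^ (((n : ℝ) - 2) / 2)| ^ (2 * n / ((n : ℝ) - 2))) ^ (1 - s / 2) := by
  have hn' : (3 : ℝ) ≤ n := by exact_mod_cast hn
  have hp0 : 0 < 2 * ((n : ℝ) - s) / ((n : ℝ) - 2) := div_pos (by linarith) (by linarith)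
  have hq0 : 0 < 2 * (n : ℝ) / ((n : ℝ) - 2) := div_pos (by linarith) (by linarith)
  have hs : 0 ≤ s / 2 := by linarith
  have hs' : 0 ≤ 1 - s / 2 := by linarith
  set c : ℝ := ((n : ℝ) - 2) / 2 with hc
  have hc0 : 0 < c := by rw [hc]; linarith
  have hfC := (integral_conformal_le hn hφ hφc hφs).1
  rw [← hc] at hfC
  set f : EuclideanSpace ℝ (Fin n) → ℝ := fun x => φ x * lam x ^ c with hf
  have hfc : HasCompactSupport f := hφc.mul_right
  set A := ∫ x, ‖fderiv ℝ φ x‖ ^ 2 * lam x ^ (n - 2) with hA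
  have hA0 : 0 ≤ A := integral_nonneg fun x => by
    by_cases hx : x ∈ tsupport φ
    · have := lam_pos (hφs hx)
      positivity
    · simp [fderiv_of_notMem_tsupport ℝ hx]
  have hm : Measurable φ := hφ.continuous.measurable
  have hlm : Measurable (lam (n := n)) := by
    unfold lam
    fun_prop
  have hdm : Measurable (dH (n := n)) := by
    unfold dH
    fun_prop
  have hF : ∫⁻ x, ENNReal.ofReal (φ x ^ 2 / dH x ^ 2 * lam x ^ n) ≤ ENNReal.ofReal (A / c ^ 2) := by
    have h := hardy_hyperbolic hn hφ hφc hφs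
    simp_rw [ENNReal.ofReal_mul (sq_nonneg (((n : ℝ) - 2) / 2))] at h
    rw [lintegral_const_mul _ (by fun_prop), ← hc, mul_comm] at h
    rw [ENNReal.ofReal_div_of_pos (by positivity)]
    exact (ENNReal.le_div_iff_mul_le (Or.inl (by simpa using hc0.ne'))
      (Or.inl ENNReal.ofReal_ne_top)).2 h
  have hG : ∫⁻ x, ENNReal.ofReal (|f x| ^ (2 * n / ((n : ℝ) - 2))) =
      ENNReal.ofReal (∫ x, |f x| ^ (2 * n / ((n : ℝ) - 2))) := by
    refine (ofReal_integral_eq_lintegral_ofReal (Continuous.integrable_of_hasCompactSupport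
      (hfC.continuous.abs.rpow_const fun x => Or.inr hq0.le)
      (hfc.comp_left (g := fun t => |t| ^ (2 * n / ((n : ℝ) - 2))) ?_))
      (Filter.Eventually.of_forall fun x => by positivity)).symm
    simp [Real.zero_rpow hq0.ne']
  have hpt : ∀ᵐ x ∂volume.restrict (Metric.ball (0 : EuclideanSpace ℝ (Fin n)) 1),
      ‖|φ x| ^ (2 * ((n : ℝ) - s) / ((n : ℝ) - 2)) / dH x ^ s * lam x ^ (n : ℝ)‖ₑ ≤
      ENNReal.ofReal (φ x ^ 2 / dH x ^ 2 * lam x ^ n) ^ (s / 2) *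
        ENNReal.ofReal (|f x| ^ (2 * n / ((n : ℝ) - 2))) ^ (1 - s / 2) := by
    have : Nonempty (Fin n) := ⟨⟨0, by omega⟩⟩
    filter_upwards [ae_restrict_mem measurableSet_ball,
      ae_restrict_of_ae (Measure.ae_ne volume (0 : EuclideanSpace ℝ (Fin n)))] with x hx hx0
    by_cases h0 : φ x = 0
    · simp [h0, Real.zero_rpow hp0.ne']
    have hΛ := lam_pos hx
    have hd : 0 < dH x := (mul_pos two_pos (norm_pos_iff.2 hx0)).trans_le (two_mul_norm_le_dH hx)
    have hu : 0 < |φ x| := abs_pos.2 h0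
    have hfx : |f x| ^ (2 * n / ((n : ℝ) - 2)) =
        |φ x| ^ (2 * n / ((n : ℝ) - 2)) * lam x ^ n := by
      have hcn : c * (2 * n / ((n : ℝ) - 2)) = n := by
        have : (n : ℝ) - 2 ≠ 0 := by linarith
        rw [hc]
        field_simp
      rw [hf, abs_mul, abs_of_pos (Real.rpow_pos_of_pos hΛ c),
        Real.mul_rpow hu.le (Real.rpow_nonneg hΛ.le c), ← Real.rpow_mul hΛ.le, hcn,
        Real.rpow_natCast]
    rw [Real.rpow_natCast, Real.enorm_of_nonneg (by positivity), hfx, ← sq_abs (φ x),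
      ENNReal.ofReal_rpow_of_nonneg (by positivity) hs,
      ENNReal.ofReal_rpow_of_nonneg (by positivity) hs', ← ENNReal.ofReal_mul (by positivity),
      hardy_sobolev_density (by linarith) hu hd (pow_pos hΛ n)]
  have hG0 : 0 ≤ ∫ x, |f x| ^ (2 * n / ((n : ℝ) - 2)) := integral_nonneg fun x => by positivity
  refine (ENNReal.ofReal_le_ofReal_iff (by positivity)).1 ?_
  refine (Real.ofReal_le_enorm _).trans ((enorm_integral_le_lintegral_enorm _).trans ?_)
  refine (lintegral_mono_ae hpt).trans ((setLIntegral_le_lintegral _ _).trans ?_)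
  have hfm : Measurable f := hfC.continuous.measurable
  refine (ENNReal.lintegral_mul_norm_pow_le (by fun_prop) (by fun_prop) hs hs'
    (add_sub_cancel _ _)).trans ?_
  rw [hG, ENNReal.ofReal_mul (by positivity), ← ENNReal.ofReal_rpow_of_nonneg (by positivity) hs,
    ← ENNReal.ofReal_rpow_of_nonneg (by positivity) hs']
  gcongr

/-- Combining the Hardy bound `J ≤ (A / c²)^(s / 2) G^(1 - s / 2)` with the Sobolev bound
`S G^((N - 2) / N) ≤ A`. -/
theorem interpolate_hardy_sobolev {N s c S A G J : ℝ} (hN : 3 ≤ N) (hs0 : 0 ≤ s) (hs2 : s ≤ 2)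
    (hc : 0 < c) (hS : 0 < S) (hA : 0 ≤ A) (hG : 0 ≤ G) (hJ : 0 ≤ J)
    (hJle : J ≤ (A / c ^ 2) ^ (s / 2) * G ^ (1 - s / 2)) (hSob : S * G ^ ((N - 2) / N) ≤ A) :
    c ^ (2 * s / (2 * (N - s) / (N - 2))) * S ^ (N * (2 - s) / (2 * (N - s))) *
      J ^ (2 / (2 * (N - s) / (N - 2))) ≤ A := by
  have hNs : 0 < N - s := by linarith
  have hN2 : 0 < N - 2 := by linarith
  have hN0 : 0 < N := by linarith
  set r := 2 / (2 * (N - s) / (N - 2)) with hr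
  set e := N * (2 - s) / (2 * (N - s)) with he
  have hr0 : 0 ≤ r := by positivity
  have he0 : 0 ≤ e := div_nonneg (mul_nonneg hN0.le (by linarith)) (by positivity)
  have e1 : c ^ (2 * s / (2 * (N - s) / (N - 2))) = (c ^ 2) ^ (s / 2 * r) := by
    rw [← Real.rpow_natCast, ← Real.rpow_mul hc.le, hr]
    congr 1
    push_cast
    ring
  have e2 : (1 - s / 2) * r = (N - 2) / N * e := by
    rw [hr, he]
    field_simp
  have e3 : s / 2 * r + e = 1 := by
    rw [hr, he]
    field_simp
    ring
  calc _ ≤ (c ^ 2) ^ (s / 2 * r) * S ^ e * ((A / c ^ 2) ^ (s / 2) * G ^ (1 - s / 2)) ^ r := by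
        rw [e1]
        gcongr
    _ = A ^ (s / 2 * r) * (S * G ^ ((N - 2) / N)) ^ e := by
        rw [Real.mul_rpow (by positivity) (by positivity), ← Real.rpow_mul (by positivity),
          ← Real.rpow_mul hG, e2, Real.rpow_mul hG, Real.mul_rpow hS.le (by positivity),
          Real.div_rpow hA (by positivity)]
        have : (c ^ 2) ^ (s / 2 * r) ≠ 0 := by positivity
        field_simp
    _ ≤ A ^ (s / 2 * r) * A ^ e := by gcongr
    _ = A := by
        rw [← Real.rpow_add_of_nonneg hA (by positivity) he0, e3, Real.rpow_one]

theorem dH_nonneg {n : ℕ} {x : EuclideanSpace ℝ (Fin n)} (hx : x ∈ Metric.ball 0 1) : 0 ≤ dH x :=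
  (mul_nonneg two_pos.le (norm_nonneg x)).trans (two_mul_norm_le_dH hx)

/-- Hardy–Sobolev inequality on hyperbolic space (Corollary 2.3). -/
theorem hardy_sobolev_hyperbolic {n : ℕ} (hn : 3 ≤ n)
    (s : ℝ) (hs0 : 0 ≤ s) (hs2 : s ≤ 2)
    (φ : EuclideanSpace ℝ (Fin n) → ℝ)
    (hφ_smooth : ContDiff ℝ (⊤ : ℕ∞) φ) (hφ_cpt : HasCompactSupport φ)
    (hφ_supp : tsupport φ ⊆ Metric.ball (0 : EuclideanSpace ℝ (Fin n)) 1) :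
    (((n : ℝ) - 2) / 2) ^ (2 * s / (2 * ((n : ℝ) - s) / ((n : ℝ) - 2))) *
        (((n : ℝ) * ((n : ℝ) - 2) / 4) * sphereVol n ^ (2 / (n : ℝ))) ^
          ((n : ℝ) * (2 - s) / (2 * ((n : ℝ) - s))) *
        (∫ x in Metric.ball (0 : EuclideanSpace ℝ (Fin n)) 1,
            |φ x| ^ (2 * ((n : ℝ) - s) / ((n : ℝ) - 2)) / dH x ^ s * lam x ^ (n : ℝ)) ^
          (2 / (2 * ((n : ℝ) - s) / ((n : ℝ) - 2))) ≤
      ∫ x in Metric.ball (0 : EuclideanSpace ℝ (Fin n)) 1,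
        ‖gradient φ x‖ ^ 2 * lam x ^ ((n : ℝ) - 2) := by
  have hn' : (3 : ℝ) ≤ n := by exact_mod_cast hn
  have hφ : ContDiff ℝ 1 φ := hφ_smooth.of_le (by exact_mod_cast le_top)
  obtain ⟨hfC, hfE⟩ := integral_conformal_le hn hφ hφ_cpt hφ_supp
  have hJ := hardy_sobolev_integral_le hn hs0 hs2 hφ hφ_cpt hφ_supp
  have hSob := (sobolev_sharp hn hfC hφ_cpt.mul_right).trans hfE
  have hS : 0 < sphereVol n := by
    rw [sphereVol_eq]
    positivity
  rw [setIntegral_energy (by omega) hφ_supp]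
  refine interpolate_hardy_sobolev hn' hs0 hs2 (by linarith)
    (mul_pos (div_pos (mul_pos (by linarith) (by linarith)) four_pos) (by positivity))
    ?_ (integral_nonneg fun x => by positivity)
    (setIntegral_nonneg measurableSet_ball fun x hx => ?_) hJ hSob
  · exact (integral_nonneg fun x => sq_nonneg _).trans hfE
  · have h1 := lam_pos hx
    have h2 := dH_nonneg hx
    positivity
end
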